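/- arXiv:1907.00461 — 14 statements merged into one kernel-verified Lean document; each statement's English description precedes it below -/
import Mathlib

section
/- Let n and i be natural numbers with 1 ≤ i and 2*i < n + 1. Let P, Q, R be polynomials over ℂ such that the degree of P is strictly less than i, Q is monic of degree i, and R is monic of degree n + 1 − 2*i. If X^(n+1) + X^i + P = Q^2 * R, then (n+1) • (Q*R) − 2 • (X * (derivative Q) * R) − X * Q * (derivative R) equals the constant polynomial n + 1 − i. -/
open Polynomial

theorem stmt_0 (n i : ℕ) (hi : 1 ≤ i) (hni : 2 * i < n + 1)
    (P Q R : Polynomial ℂ)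
    (hP : P.degree < (i : WithBot ℕ))
    (hQmonic : Q.Monic) (hQdeg : Q.natDegree = i)
    (hRmonic : R.Monic) (hRdeg : R.natDegree = n + 1 - 2 * i)
    (heq : X ^ (n + 1) + X ^ i + P = Q ^ 2 * R) :
    (n + 1) • (Q * R) - 2 • (X * derivative Q * R) - X * Q * derivative R
      = C ((n : ℂ) + 1 - (i : ℂ)) := by
  have hd := congrArg derivative heq
  obtain ⟨k, rfl⟩ : ∃ k, i = k + 1 := ⟨i - 1, by omega⟩
  have hQd : Q.degree = ((k + 1 : ℕ) : WithBot ℕ) := by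
    rw [degree_eq_natDegree hQmonic.ne_zero, hQdeg]
  have h1 : (X ^ (k + 1) - Q).degree < ((k + 1 : ℕ) : WithBot ℕ) := by
    have := degree_sub_lt (p := (X ^ (k + 1) : ℂ[X])) (q := Q) (by rw [hQd, degree_X_pow])
      (pow_ne_zero _ X_ne_zero) (by rw [hQmonic.leadingCoeff, (monic_X_pow _).leadingCoeff])
    rwa [degree_X_pow] at this
  rw [degree_lt_iff_coeff_zero] at h1 hP
  simp only [derivative_add, derivative_mul, derivative_X_pow, derivative_pow] at hd
  have key : Q * ((n + 1) • (Q * R) - 2 • (X * derivative Q * R) - X * Q * derivative R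
      - C ((n : ℂ) + 1 - ((k + 1 : ℕ) : ℂ)))
      = C ((n : ℂ) + 1 - ((k + 1 : ℕ) : ℂ)) * (X ^ (k + 1) - Q) + C ((n : ℂ) + 1) * P
        - X * derivative P := by
    have h2 : (C 2 : ℂ[X]) = 2 := rfl
    simp [h2] at hd ⊢
    linear_combination (-(n + 1 : ℂ[X])) * heq + X * hd
  rw [← sub_eq_zero]
  by_contra hne
  have hlt : (Q * ((n + 1) • (Q * R) - 2 • (X * derivative Q * R) - X * Q * derivative R
      - C ((n : ℂ) + 1 - ((k + 1 : ℕ) : ℂ)))).degree < ((k + 1 : ℕ) : WithBot ℕ) := by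
    rw [key, degree_lt_iff_coeff_zero]
    intro m hm
    obtain ⟨j, rfl⟩ : ∃ j, m = j + 1 := ⟨m - 1, by omega⟩
    rw [coeff_sub, coeff_add, coeff_C_mul, coeff_C_mul, coeff_X_mul, coeff_derivative,
      h1 _ hm, hP _ hm]
    simp
  rw [degree_mul, hQd, degree_eq_natDegree hne] at hlt
  rw [← Nat.cast_add, Nat.cast_lt] at hlt
  omega
end

section
/- Let n and i be natural numbers with 1 ≤ i and 2*i < n + 1. Let P, Q, R be polynomials over ℂ such that the degree of P is strictly less than i, Q is monic of degree i, and R is monic of degree n + 1 − 2*i. If X^(n+1) + X^i + P = Q^2 * R, then (n+1−i) • Q = (n+1−i) • X^i + (n+1) • P − X * (derivative P). In particular, Q is uniquely determined by P. -/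
open Polynomial

theorem stmt_1 (n i : ℕ) (hi : 1 ≤ i) (hni : 2 * i < n + 1)
    (P Q R : Polynomial ℂ)
    (hP : P.degree < (i : WithBot ℕ))
    (hQmonic : Q.Monic) (hQdeg : Q.natDegree = i)
    (hRmonic : R.Monic) (hRdeg : R.natDegree = n + 1 - 2 * i)
    (heq : X ^ (n + 1) + X ^ i + P = Q ^ 2 * R) :
    (n + 1 - i) • Q = (n + 1 - i) • X ^ i + (n + 1) • P - X * derivative P := by
  obtain ⟨m, hm⟩ : ∃ m, n + 1 = i + m := ⟨n + 1 - i, by omega⟩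
  have hmi : n + 1 - i = m := by omega
  rw [hmi]
  have hc : ((n : ℂ[X]) + 1) = i + m := by exact_mod_cast congrArg (Nat.cast : ℕ → ℂ[X]) hm
  obtain ⟨j, rfl⟩ : ∃ j, i = j + 1 := ⟨i - 1, by omega⟩
  have hd := congrArg derivative heq
  simp only [derivative_add, derivative_mul, derivative_pow, derivative_X, map_natCast,
    Nat.add_sub_cancel] at hd
  have hdvd : Q ∣ m • Q - (m • X ^ (j + 1) + (n + 1) • P - X * derivative P) := by
    refine ⟨(m : ℂ[X]) - (((n : ℂ[X]) + 1) * Q * R - X * (2 * derivative Q * R + Q * derivative R)), ?_⟩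
    simp only [nsmul_eq_mul]
    push_cast at hd hc ⊢
    linear_combination -(n + 1 : ℂ[X]) * heq + X * hd + X ^ (j + 1) * hc
  have hdeg : (m • Q - (m • X ^ (j + 1) + (n + 1) • P - X * derivative P)).degree < Q.degree := by
    rw [degree_eq_natDegree hQmonic.ne_zero, hQdeg, degree_lt_iff_coeff_zero]
    rw [degree_lt_iff_coeff_zero] at hP
    intro k hk
    have hQk : Q.coeff k = (X ^ (j + 1) : ℂ[X]).coeff k := by
      rw [coeff_X_pow]
      split_ifs with h
      · rw [h, ← hQdeg]; exact hQmonic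
      · exact coeff_eq_zero_of_natDegree_lt (by omega)
    obtain ⟨l, rfl⟩ : ∃ l, k = l + 1 := ⟨k - 1, by omega⟩
    simp only [coeff_sub, coeff_add, coeff_smul, coeff_X_mul, coeff_derivative, hQk, hP _ hk]
    simp
  exact sub_eq_zero.mp (eq_zero_of_dvd_of_degree_lt hdvd hdeg)
end

section
/- Let n and i be natural numbers with 1 ≤ i and 2*i < n + 1, and let P be a polynomial over ℂ of degree strictly less than i. Then there is at most one pair (Q, R) of polynomials over ℂ with Q monic of degree i and R monic of degree n + 1 − 2*i such that X^(n+1) + X^i + P = Q^2 * R. -/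
open Polynomial

theorem aux_Q (n i : ℕ) (hi : 1 ≤ i)
    (P : Polynomial ℂ) (hP : P.degree < (i : WithBot ℕ))
    (Q R : Polynomial ℂ)
    (hQ : Q.Monic) (hQd : Q.natDegree = i)
    (heq : X ^ (n + 1) + X ^ i + P = Q ^ 2 * R) :
    C ((n : ℂ) + 1 - i) * Q
      = C ((n : ℂ) + 1 - i) * X ^ i + C ((n : ℂ) + 1) * P - X * derivative P := by
  have hd := congrArg derivative heq
  simp only [derivative_add, derivative_mul, derivative_X_pow, derivative_pow] at hd
  obtain ⟨j, rfl⟩ : ∃ j, i = j + 1 := ⟨i - 1, by omega⟩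
  symm
  rw [← sub_eq_zero]
  apply eq_zero_of_dvd_of_degree_lt (p := Q)
  · refine ⟨C ((n : ℂ) + 1) * (Q * R) - X * (C 2 * derivative Q * R + Q * derivative R)
      - C ((n : ℂ) + 1 - (j + 1 : ℕ)), ?_⟩
    simp at hd heq ⊢
    linear_combination ((n : ℂ[X]) + 1) * heq - X * hd
  · rw [degree_eq_natDegree hQ.ne_zero, hQd, degree_lt_iff_coeff_zero]
    rw [degree_lt_iff_coeff_zero] at hP
    intro m hm
    obtain ⟨k, rfl⟩ : ∃ k, m = k + 1 := ⟨m - 1, by omega⟩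
    rw [coeff_sub, coeff_sub, coeff_add, coeff_C_mul, coeff_C_mul, coeff_C_mul, coeff_X_mul,
      coeff_derivative, hP _ hm, coeff_X_pow]
    rcases hm.eq_or_lt with h | h
    · have : Q.coeff (k + 1) = 1 := by rw [← h, ← hQd]; exact hQ
      rw [this]; simp [h]
    · rw [coeff_eq_zero_of_natDegree_lt (by omega), if_neg (by omega)]; simp

theorem stmt_2 (n i : ℕ) (hi : 1 ≤ i) (hni : 2 * i < n + 1)
    (P : Polynomial ℂ) (hP : P.degree < (i : WithBot ℕ))
    (Q₁ R₁ Q₂ R₂ : Polynomial ℂ)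
    (hQ₁monic : Q₁.Monic) (hQ₁deg : Q₁.natDegree = i)
    (hR₁monic : R₁.Monic) (hR₁deg : R₁.natDegree = n + 1 - 2 * i)
    (heq₁ : X ^ (n + 1) + X ^ i + P = Q₁ ^ 2 * R₁)
    (hQ₂monic : Q₂.Monic) (hQ₂deg : Q₂.natDegree = i)
    (hR₂monic : R₂.Monic) (hR₂deg : R₂.natDegree = n + 1 - 2 * i)
    (heq₂ : X ^ (n + 1) + X ^ i + P = Q₂ ^ 2 * R₂) :
    Q₁ = Q₂ ∧ R₁ = R₂ := by
  have h1 := aux_Q n i hi P hP Q₁ R₁ hQ₁monic hQ₁deg heq₁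
  have h2 := aux_Q n i hi P hP Q₂ R₂ hQ₂monic hQ₂deg heq₂
  have hc : (n : ℂ) + 1 - i ≠ 0 := by
    rw [sub_ne_zero]
    norm_cast
    omega
  have hQ : Q₁ = Q₂ := mul_left_cancel₀ (C_ne_zero.mpr hc) (h1.trans h2.symm)
  subst hQ
  exact ⟨rfl, mul_left_cancel₀ (pow_ne_zero 2 hQ₁monic.ne_zero) (heq₁.symm.trans heq₂)⟩
end

section
/- Let n and i be natural numbers with 1 ≤ i and 2*i < n + 1. Let Q and R be polynomials over ℂ with Q monic of degree i and R monic of degree n + 1 − 2*i, and suppose (n+1) • (Q*R) − 2 • (X * (derivative Q) * R) − X * Q * (derivative R) equals the constant polynomial n + 1 − i. Then the polynomial Q^2 * R − X^(n+1) − X^i has degree strictly less than i; equivalently, X^(n+1) + X^i + P = Q^2 * R for a (unique) polynomial P of degree strictly less than i. -/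
open Polynomial

theorem stmt_3 (n i : ℕ) (hi : 1 ≤ i) (hni : 2 * i < n + 1)
    (Q R : Polynomial ℂ)
    (hQmonic : Q.Monic) (hQdeg : Q.natDegree = i)
    (hRmonic : R.Monic) (hRdeg : R.natDegree = n + 1 - 2 * i)
    (hid : (n + 1) • (Q * R) - 2 • (X * derivative Q * R) - X * Q * derivative R
      = C ((n : ℂ) + 1 - (i : ℂ))) :
    (Q ^ 2 * R - X ^ (n + 1) - X ^ i).degree < (i : WithBot ℕ) := by
  have hF : C ((n : ℂ) + 1) * (Q ^ 2 * R) - X * derivative (Q ^ 2 * R)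
      = C ((n : ℂ) + 1 - (i : ℂ)) * Q := by
    rw [← hid]
    simp only [nsmul_eq_mul, derivative_mul, derivative_pow, map_add, map_one, map_natCast]
    push_cast
    ring
  have hmon : (Q ^ 2 * R).Monic := (hQmonic.pow 2).mul hRmonic
  have hdeg : (Q ^ 2 * R).natDegree = n + 1 := by
    rw [(hQmonic.pow 2).natDegree_mul hRmonic, hQmonic.natDegree_pow, hQdeg, hRdeg]
    omega
  have hlead : (Q ^ 2 * R).coeff (n + 1) = 1 := by
    rw [← hdeg]; exact hmon.coeff_natDegree
  have hQi : Q.coeff i = 1 := by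
    rw [← hQdeg]; exact hQmonic.coeff_natDegree
  generalize Q ^ 2 * R = F at *
  have hk : ∀ k, ((n : ℂ) + 1 - k) * F.coeff k = ((n : ℂ) + 1 - i) * Q.coeff k := by
    intro k
    have h := congrArg (fun p => coeff p k) hF
    simp only [coeff_sub, coeff_C_mul] at h
    rw [← h]
    cases k with
    | zero => simp
    | succ k => rw [coeff_X_mul, coeff_derivative]; push_cast; ring
  have hne : ∀ k : ℕ, k ≠ n + 1 → ((n : ℂ) + 1 - k) ≠ 0 := by
    intro k hk h
    apply hk
    have : ((n + 1 : ℕ) : ℂ) = k := by push_cast; exact sub_eq_zero.mp h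
    exact_mod_cast this.symm
  rw [degree_lt_iff_coeff_zero]
  intro m hm
  simp only [coeff_sub, coeff_X_pow]
  by_cases h1 : m = n + 1
  · subst h1
    rw [hlead, if_pos rfl, if_neg (by omega)]; simp
  · by_cases h2 : m = i
    · subst h2
      have := hk m
      rw [hQi] at this
      rw [mul_left_cancel₀ (hne m h1) this, if_neg h1, if_pos rfl]; simp
    · have := hk m
      rw [coeff_eq_zero_of_natDegree_lt (by omega : Q.natDegree < m), mul_zero] at this
      rw [(mul_eq_zero.mp this).resolve_left (hne m h1), if_neg h1, if_neg h2]; simp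
end

section
/- For every natural number k ≥ 1, there is exactly one pair (P, Q) of polynomials over ℂ with degree of P strictly less than k and Q monic of degree k such that X^(2k) + X^k + P = Q^2; namely P is the constant polynomial 1/4 and Q = X^k + 1/2. In particular both P and Q have real coefficients. -/
open Polynomial

theorem stmt_4_aux (k : ℕ) (hk : 1 ≤ k) (P Q : Polynomial ℂ) (hP : P.degree < (k : WithBot ℕ))
    (hQ : Q.Monic) (hd : Q.natDegree = k) (h : X ^ (2 * k) + X ^ k + P = Q ^ 2) :
    P = C (1 / 4 : ℂ) ∧ Q = X ^ k + C (1 / 2 : ℂ) := by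
  have e1 : (C (1 / 2 : ℂ)) + C (1 / 2 : ℂ) = 1 := by
    rw [← C_add, ← C_1]; norm_num
  have e2 : (C (1 / 2 : ℂ)) * C (1 / 2 : ℂ) = C (1 / 4 : ℂ) := by
    rw [← C_mul]; norm_num
  have key : (Q - (X ^ k + C (1 / 2 : ℂ))) * (Q + (X ^ k + C (1 / 2 : ℂ))) = P - C (1 / 4 : ℂ) := by
    linear_combination (-1 : ℂ[X]) * h - X ^ k * e1 - e2
  have hk0 : (0 : WithBot ℕ) < (k : WithBot ℕ) := by exact_mod_cast hk
  have hlt : (P - C (1 / 4 : ℂ)).degree < (k : WithBot ℕ) :=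
    lt_of_le_of_lt (degree_sub_le _ _) (max_lt hP (lt_of_le_of_lt degree_C_le hk0))
  have hc : (Q + (X ^ k + C (1 / 2 : ℂ))).coeff k = 2 := by
    have h1 : Q.coeff k = 1 := by rw [← hd]; exact hQ
    have h2 : k ≠ 0 := by omega
    rw [coeff_add, coeff_add, h1, coeff_X_pow_self, coeff_C_ne_zero h2]; norm_num
  have hge : (k : WithBot ℕ) ≤ (Q + (X ^ k + C (1 / 2 : ℂ))).degree :=
    le_degree_of_ne_zero (by rw [hc]; norm_num)
  have hz : Q - (X ^ k + C (1 / 2 : ℂ)) = 0 := by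
    by_contra hne
    have h0 : 0 ≤ (Q - (X ^ k + C (1 / 2 : ℂ))).degree := zero_le_degree_iff.mpr hne
    rw [← key, degree_mul] at hlt
    have := add_le_add h0 hge
    rw [zero_add] at this
    exact absurd hlt (not_lt.mpr this)
  rw [hz, zero_mul] at key
  exact ⟨(sub_eq_zero.mp key.symm), sub_eq_zero.mp hz⟩

theorem stmt_4 (k : ℕ) (hk : 1 ≤ k) :
    (∃! pq : Polynomial ℂ × Polynomial ℂ,
      pq.1.degree < (k : WithBot ℕ) ∧ pq.2.Monic ∧ pq.2.natDegree = k ∧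
        X ^ (2 * k) + X ^ k + pq.1 = pq.2 ^ 2) ∧
    ∀ P Q : Polynomial ℂ, P.degree < (k : WithBot ℕ) → Q.Monic → Q.natDegree = k →
      X ^ (2 * k) + X ^ k + P = Q ^ 2 →
        P = C (1 / 4 : ℂ) ∧ Q = X ^ k + C (1 / 2 : ℂ) := by
  refine ⟨⟨(C (1 / 4 : ℂ), X ^ k + C (1 / 2 : ℂ)), ⟨?_, ?_, ?_, ?_⟩, ?_⟩, stmt_4_aux k hk⟩
  · have hk0 : (0 : WithBot ℕ) < (k : WithBot ℕ) := by exact_mod_cast hk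
    exact lt_of_le_of_lt degree_C_le hk0
  · exact monic_X_pow_add_C _ (by omega)
  · exact natDegree_X_pow_add_C
  · have e1 : (C (1 / 2 : ℂ)) + C (1 / 2 : ℂ) = 1 := by
      rw [← C_add, ← C_1]; norm_num
    have e2 : (C (1 / 2 : ℂ)) * C (1 / 2 : ℂ) = C (1 / 4 : ℂ) := by
      rw [← C_mul]; norm_num
    show X ^ (2 * k) + X ^ k + C (1 / 4 : ℂ) = (X ^ k + C (1 / 2 : ℂ)) ^ 2
    linear_combination - X ^ k * e1 - e2
  · rintro ⟨P, Q⟩ ⟨h1, h2, h3, h4⟩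
    obtain ⟨a, b⟩ := stmt_4_aux k hk P Q h1 h2 h3 h4
    rw [a, b]
end

section
/- For every natural number k ≥ 1, the set of pairs (Q, β) with Q a monic polynomial of degree k over ℂ and β ∈ ℂ, such that the polynomial Q^2 * (X + β) − X^(2k+1) − X^k has degree strictly less than k, is finite of cardinality exactly k + 1. -/
open Polynomial

noncomputable def serA : PowerSeries ℂ := PowerSeries.binomialSeries ℂ (-1/2 : ℂ)

lemma serA_sq : serA * serA * (1 + PowerSeries.X) = 1 := by
  have h1 : PowerSeries.binomialSeries ℂ (1 : ℂ) = (1 + PowerSeries.X : PowerSeries ℂ) := by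
    simpa using PowerSeries.binomialSeries_nat (R := ℂ) (A := ℂ) 1
  unfold serA
  rw [← h1, ← PowerSeries.binomialSeries_add, ← PowerSeries.binomialSeries_add]
  norm_num

lemma serA_zero : PowerSeries.constantCoeff serA = 1 := by
  simp [serA]

lemma serA_ne (n : ℕ) : PowerSeries.coeff n serA ≠ 0 := by
  have h := Ring.descPochhammer_eq_factorial_smul_choose (-1/2 : ℂ) n
  rw [serA, PowerSeries.binomialSeries_coeff]
  intro h0
  have h1 : Ring.choose (-1/2 : ℂ) n = 0 := by simpa using h0
  rw [h1, smul_zero] at h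
  have : ∀ m : ℕ, (descPochhammer ℤ m).smeval (-1/2 : ℂ) ≠ 0 := by
    intro m
    induction m with
    | zero => simp
    | succ m ih =>
      rw [descPochhammer_succ_right, Polynomial.smeval_mul]
      refine mul_ne_zero ih ?_
      rw [Polynomial.smeval_sub, Polynomial.smeval_X, Polynomial.smeval_natCast]
      intro h
      have h2 : ((2 * m + 1 : ℕ) : ℂ) = 0 := by
        push_cast
        simp at h
        linear_combination (-2) * h
      exact absurd (Nat.cast_eq_zero.mp h2) (by omega)
  exact this n h

noncomputable def serS (b : ℂ) : PowerSeries ℂ := PowerSeries.rescale b serA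

lemma serS_sq (b : ℂ) : serS b ^ 2 * (1 + PowerSeries.C b * PowerSeries.X) = 1 := by
  have := congrArg (PowerSeries.rescale b) serA_sq
  simp only [map_mul, map_add, map_one, PowerSeries.rescale_X] at this
  rw [serS, sq]; exact this

lemma serS_coeff (b : ℂ) (n : ℕ) :
    PowerSeries.coeff n (serS b) = b ^ n * PowerSeries.coeff n serA := by
  simp [serS]

lemma serS_zero (b : ℂ) : PowerSeries.constantCoeff (serS b) = 1 := by
  rw [← PowerSeries.coeff_zero_eq_constantCoeff_apply, serS_coeff]
  simp [serA_zero]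

lemma key (k : ℕ) (b : ℂ) (q : PowerSeries ℂ) (h0 : PowerSeries.constantCoeff q = 1) :
    (PowerSeries.X ^ (k + 2) ∣ q ^ 2 * (1 + PowerSeries.C b * PowerSeries.X) - 1
        - PowerSeries.X ^ (k + 1)) ↔
      ∀ i < k + 2, PowerSeries.coeff i (q - serS b) = if i = k + 1 then 1 / 2 else 0 := by
  set U : PowerSeries ℂ := (q + serS b) * (1 + PowerSeries.C b * PowerSeries.X) with hU
  have hU0 : PowerSeries.constantCoeff U = 2 := by
    simp [hU, h0, serS_zero]; norm_num
  have e : q ^ 2 * (1 + PowerSeries.C b * PowerSeries.X) - 1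
        - PowerSeries.X ^ (k + 1) = (q - serS b) * U - PowerSeries.X ^ (k + 1) := by
    rw [hU]; linear_combination serS_sq b
  have hUu : IsUnit U := by
    rw [PowerSeries.isUnit_iff_constantCoeff, hU0]; norm_num
  -- U = 2 + X * V
  obtain ⟨V, hV⟩ : PowerSeries.X ∣ U - PowerSeries.C 2 := by
    rw [PowerSeries.X_dvd_iff]; simp [hU0]
  have hCC : (PowerSeries.C (2:ℂ)) * PowerSeries.C (1/2 : ℂ) = 1 := by
    rw [← map_mul]; norm_num
  have e2 : (q - serS b) * U - PowerSeries.X ^ (k + 1) =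
      (q - serS b - PowerSeries.C (1/2) * PowerSeries.X ^ (k+1)) * U
        + PowerSeries.X ^ (k + 2) * (PowerSeries.C (1/2) * V) := by
    linear_combination PowerSeries.C (1/2) * PowerSeries.X ^ (k+1) * hV
      + PowerSeries.X ^ (k+1) * hCC
  rw [e, e2, dvd_add_left (dvd_mul_right _ _), hUu.dvd_mul_right, PowerSeries.X_pow_dvd_iff]
  refine forall₂_congr fun i _ => ?_
  rw [map_sub, PowerSeries.coeff_C_mul, PowerSeries.coeff_X_pow, sub_eq_zero]
  simp

noncomputable def polQ (k : ℕ) (b : ℂ) : ℂ[X] := reflect k (PowerSeries.trunc (k+1) (serS b))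

lemma reflect_invol (N : ℕ) (f : ℂ[X]) : reflect N (reflect N f) = f := by
  ext i; simp

lemma natDegree_reflect_le' (k : ℕ) (f : ℂ[X]) (hf : f.natDegree ≤ k) :
    (reflect k f).natDegree ≤ k := by
  rw [natDegree_le_iff_coeff_eq_zero]
  intro i hi
  rw [coeff_reflect, revAt_eq_self_of_lt hi]
  exact coeff_eq_zero_of_natDegree_lt (by omega)

lemma cond_iff (k : ℕ) (b : ℂ) (Q : ℂ[X]) (hQ : Q.natDegree ≤ k) :
    (Q ^ 2 * (X + C b) - X ^ (2 * k + 1) - X ^ k).degree < (k : WithBot ℕ) ↔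
    PowerSeries.X ^ (k + 2) ∣ ((reflect k Q : ℂ[X]) : PowerSeries ℂ) ^ 2 *
      (1 + PowerSeries.C b * PowerSeries.X) - 1 - PowerSeries.X ^ (k + 1) := by
  set F := Q ^ 2 * (X + C b) - X ^ (2 * k + 1) - X ^ k with hF
  have hr : reflect (2 * k + 1) F = (reflect k Q) ^ 2 * (1 + C b * X) - 1 - X ^ (k+1) := by
    have h1 : (X + C b).natDegree ≤ 1 := by simp
    have h2 : (Q * Q).natDegree ≤ k + k := natDegree_mul_le_of_le hQ hQ
    rw [hF, reflect_sub, reflect_sub, reflect_monomial, reflect_monomial, sq, two_mul,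
      reflect_mul _ _ h2 h1, reflect_mul _ _ hQ hQ, reflect_add, reflect_one_X, reflect_C,
      revAt_le (by omega), revAt_le (by omega)]
    rw [show k + k + 1 - (k + k + 1) = 0 by omega, show k + k + 1 - k = k + 1 by omega]
    ring
  have hFd : F.natDegree ≤ 2 * k + 1 := by
    have h2 : (Q ^ 2 * (X + C b)).natDegree ≤ 2 * k + 1 :=
      natDegree_mul_le_of_le (natDegree_pow_le_of_le 2 hQ) (by simp)
    refine (natDegree_sub_le_of_le (natDegree_sub_le_of_le h2 (natDegree_X_pow_le _))
      (natDegree_X_pow_le _)).trans ?_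
    simp; omega
  have hc : ((reflect k Q : ℂ[X]) : PowerSeries ℂ) ^ 2 *
      (1 + PowerSeries.C b * PowerSeries.X) - 1 - PowerSeries.X ^ (k + 1)
      = ((reflect (2 * k + 1) F : ℂ[X]) : PowerSeries ℂ) := by
    rw [hr]; simp
  rw [hc, PowerSeries.X_pow_dvd_iff, degree_lt_iff_coeff_zero]
  constructor
  · intro h i hi
    rw [Polynomial.coeff_coe, coeff_reflect]
    rw [revAt_le (by omega)]
    exact h _ (by omega)
  · intro h m hm
    by_cases hm2 : m ≤ 2 * k + 1
    · have := h (2 * k + 1 - m) (by omega)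
      rw [Polynomial.coeff_coe, coeff_reflect, revAt_le (by omega)] at this
      rwa [show 2 * k + 1 - (2 * k + 1 - m) = m by omega] at this
    · exact coeff_eq_zero_of_natDegree_lt (by omega)

lemma set_eq (k : ℕ) : {qb : Polynomial ℂ × ℂ | qb.1.Monic ∧ qb.1.natDegree = k ∧
      (qb.1 ^ 2 * (X + C qb.2) - X ^ (2 * k + 1) - X ^ k).degree < (k : WithBot ℕ)} =
    (fun b => (polQ k b, b)) ''
      {b : ℂ | b ^ (k + 1) = -(1 / 2) / PowerSeries.coeff (k+1) serA} := by
  have hA := serA_ne (k+1)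
  have hroot : ∀ b : ℂ, b ^ (k + 1) = -(1 / 2) / PowerSeries.coeff (k+1) serA ↔
      - PowerSeries.coeff (k+1) (serS b) = 1 / 2 := by
    intro b
    rw [serS_coeff, eq_div_iff hA, neg_eq_iff_eq_neg]
  have htd : ∀ b, (PowerSeries.trunc (k+1) (serS b)).natDegree ≤ k := fun b =>
    Nat.lt_succ_iff.mp (PowerSeries.natDegree_trunc_lt _ _)
  ext ⟨Q, b⟩
  simp only [Set.mem_ofPred_eq, Set.mem_image, Prod.mk.injEq]
  constructor
  · rintro ⟨hm, hd, hc⟩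
    have h0 : PowerSeries.constantCoeff ((reflect k Q : ℂ[X]) : PowerSeries ℂ) = 1 := by
      rw [← PowerSeries.coeff_zero_eq_constantCoeff_apply, Polynomial.coeff_coe, coeff_reflect,
        revAt_zero, ← hd]
      exact hm
    have hdr := natDegree_reflect_le' k Q hd.le
    rw [cond_iff k b Q hd.le, key k b _ h0] at hc
    refine ⟨b, ?_, ?_, rfl⟩
    · rw [hroot]
      have := hc (k+1) (by omega)
      rw [map_sub, Polynomial.coeff_coe, coeff_eq_zero_of_natDegree_lt (by omega)] at this
      simpa using this
    · rw [polQ, ← reflect_invol k Q]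
      congr 1
      ext i
      rw [PowerSeries.coeff_trunc]
      split_ifs with hi
      · have := hc i (by omega)
        rw [map_sub, Polynomial.coeff_coe, if_neg (by omega), sub_eq_zero] at this
        exact this.symm
      · exact (coeff_eq_zero_of_natDegree_lt (by omega)).symm
  · rintro ⟨b, hb, rfl, rfl⟩
    rw [hroot] at hb
    have hd := natDegree_reflect_le' k _ (htd b)
    have hk : (polQ k b).coeff k = 1 := by
      rw [polQ, coeff_reflect, revAt_le le_rfl, PowerSeries.coeff_trunc]
      simp [serS_zero]
    have hd' : (polQ k b).natDegree = k :=
      le_antisymm hd (le_natDegree_of_ne_zero (by rw [hk]; exact one_ne_zero))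
    refine ⟨?_, hd', ?_⟩
    · rw [Monic, leadingCoeff, hd', hk]
    · rw [cond_iff k b _ hd'.le, key, polQ, reflect_invol]
      · intro i hi
        rw [map_sub, Polynomial.coeff_coe, PowerSeries.coeff_trunc]
        by_cases h : i = k + 1
        · subst h
          simpa using hb
        · rw [if_pos (by omega), if_neg h, sub_self]
      · rw [← PowerSeries.coeff_zero_eq_constantCoeff_apply, Polynomial.coeff_coe, coeff_reflect,
          revAt_zero, hk]

lemma roots_card (n : ℕ) (hn : 0 < n) (c : ℂ) (hc : c ≠ 0) :
    {b : ℂ | b ^ n = c}.Finite ∧ {b : ℂ | b ^ n = c}.ncard = n := by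
  have he : {b : ℂ | b ^ n = c} = ((nthRoots n c).toFinset : Set ℂ) := by
    ext b; simp [mem_nthRoots hn]
  have hnz : (n : ℂ) ≠ 0 := by exact_mod_cast hn.ne'
  have hs : (X ^ n - C c : ℂ[X]).Separable := separable_X_pow_sub_C c hnz hc
  refine ⟨by rw [he]; exact Finset.finite_toSet _, ?_⟩
  rw [he, Set.ncard_coe_finset, nthRoots, Multiset.toFinset_card_of_nodup (nodup_roots hs)]
  rw [← (IsAlgClosed.splits _).natDegree_eq_card_roots, natDegree_X_pow_sub_C]

theorem stmt_5 (k : ℕ) (hk : 1 ≤ k) :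
    {qb : Polynomial ℂ × ℂ | qb.1.Monic ∧ qb.1.natDegree = k ∧
      (qb.1 ^ 2 * (X + C qb.2) - X ^ (2 * k + 1) - X ^ k).degree < (k : WithBot ℕ)}.Finite ∧
    {qb : Polynomial ℂ × ℂ | qb.1.Monic ∧ qb.1.natDegree = k ∧
      (qb.1 ^ 2 * (X + C qb.2) - X ^ (2 * k + 1) - X ^ k).degree < (k : WithBot ℕ)}.ncard
        = k + 1 := by
  rw [set_eq]
  have hA := serA_ne (k+1)
  obtain ⟨h1, h2⟩ := roots_card (k+1) (by omega) (-(1 / 2) / PowerSeries.coeff (k+1) serA)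
    (div_ne_zero (by norm_num) hA)
  refine ⟨h1.image _, ?_⟩
  rw [Set.ncard_image_of_injective _ (fun a b h => (Prod.mk.inj h).2), h2]
end

section
/- Let k ≥ 1 be an odd natural number. Then there is no pair (Q, β) with Q a monic polynomial of degree k over ℝ and β ∈ ℝ such that the polynomial Q^2 * (X + β) − X^(2k+1) − X^k has degree strictly less than k. -/
open Polynomial

theorem stmt_6 (k : ℕ) (hk : 1 ≤ k) (hodd : Odd k) :
    ¬ ∃ (Q : Polynomial ℝ) (β : ℝ), Q.Monic ∧ Q.natDegree = k ∧
      (Q ^ 2 * (X + C β) - X ^ (2 * k + 1) - X ^ k).degree < (k : WithBot ℕ) := by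
  rintro ⟨Q, β, hQ, hd, hD⟩
  generalize hDdef : Q ^ 2 * (X + C β) - X ^ (2 * k + 1) - X ^ k = D at hD
  have hF : Q ^ 2 * (X + C β) = X ^ (2 * k + 1) + X ^ k + D := by rw [← hDdef]; ring
  obtain ⟨S, hS⟩ : ∃ S : ℝ[X], S = X * (2 * derivative Q * (X + C β) + Q)
      - C (2 * (k:ℝ) + 1) * (Q * (X + C β)) := ⟨_, rfl⟩
  have hDk : ∀ n, k ≤ n → D.coeff n = 0 := fun n hn =>
    coeff_eq_zero_of_degree_lt (lt_of_lt_of_le hD (by exact_mod_cast hn))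
  have hQS : Q * S = X * derivative D - C (2 * (k:ℝ) + 1) * D - C ((k:ℝ) + 1) * X ^ k := by
    have hC2 : (C (2:ℝ) : ℝ[X]) = 2 := rfl
    have h1 := congrArg derivative hF
    obtain ⟨m, rfl⟩ : ∃ m, k = m + 1 := ⟨k - 1, by omega⟩
    simp only [derivative_mul, derivative_add, derivative_X_pow, derivative_X, derivative_C,
      derivative_pow] at h1
    have h2 : Q * S = X * (C ((2:ℕ):ℝ) * Q ^ (2 - 1) * derivative Q * (X + C β) + Q ^ 2 * (1 + 0))
        - C (2 * ((m + 1 : ℕ):ℝ) + 1) * (Q ^ 2 * (X + C β)) := by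
      rw [hS]; simp [hC2]; ring
    rw [h2, h1, hF]
    simp [hC2]
    ring
  have hco : ∀ n, k ≤ n → (Q * S).coeff n = if n = k then -((k:ℝ) + 1) else 0 := by
    intro n hn
    obtain ⟨m, rfl⟩ : ∃ m, n = m + 1 := ⟨n - 1, by omega⟩
    rw [hQS]
    simp only [coeff_sub, coeff_X_mul, coeff_C_mul, coeff_derivative, hDk _ hn, coeff_X_pow]
    split_ifs <;> simp
  have hS0 : S.natDegree = 0 := by
    by_cases h0 : S = 0
    · simp [h0]
    have h1 : (Q * S).natDegree ≤ k := by
      rw [natDegree_le_iff_coeff_eq_zero]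
      intro n hn
      rw [hco n hn.le, if_neg (by omega)]
    rw [hQ.natDegree_mul' h0, hd] at h1
    omega
  rw [natDegree_eq_zero] at hS0
  obtain ⟨c, hc⟩ := hS0
  have hQk : Q.coeff k = 1 := by rw [← hd]; exact hQ
  have hcv : c = -((k:ℝ) + 1) := by
    have := hco k le_rfl
    rw [← hc, coeff_mul_C, hQk] at this
    simpa using this
  have hrec : ∀ j : ℕ, (2 * (j:ℝ) - 2 * k) * Q.coeff j
      + (2 * (j:ℝ) + 1 - 2 * k) * β * Q.coeff (j+1) = 0 := by
    intro j
    have h1 : S.coeff (j+1) = 0 := by rw [← hc]; simp [coeff_C]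
    have h3 : S = 2 * (X * (derivative Q * X + derivative Q * C β)) + X * Q
        - C (2 * (k:ℝ) + 1) * (Q * X + Q * C β) := by rw [hS]; ring
    have h4 : (derivative Q * X).coeff j = j * Q.coeff j := by
      cases j with
      | zero => simp
      | succ i => rw [coeff_mul_X, coeff_derivative]; push_cast; ring
    rw [h3, show (2:ℝ[X]) = C 2 from rfl] at h1
    simp only [coeff_sub, coeff_add, coeff_C_mul, coeff_X_mul, coeff_mul_X, coeff_mul_C, h4,
      coeff_derivative] at h1
    linarith
  have h0 : (2 * (k:ℝ) + 1) * β * Q.coeff 0 = k + 1 := by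
    have h1 : S.coeff 0 = c := by rw [← hc]; simp
    rw [hS, hcv] at h1
    simp [mul_coeff_zero] at h1
    linarith
  have hind : ∀ i, i ≤ k → ∃ a : ℝ, 0 < a ∧ Q.coeff (k - i) = a * (-β) ^ i := by
    intro i
    induction i with
    | zero => intro _; exact ⟨1, one_pos, by simp [hQk]⟩
    | succ i ih =>
      intro hi
      obtain ⟨a, ha, hq⟩ := ih (by omega)
      have h := hrec (k - (i+1))
      rw [show k - (i+1) + 1 = k - i by omega, hq, Nat.cast_sub hi] at h
      push_cast at h
      refine ⟨a * (2 * i + 1) / (2 * (i + 1)), by positivity, ?_⟩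
      have : (0:ℝ) < 2 * (i + 1) := by positivity
      field_simp
      rw [pow_succ]
      linarith
  obtain ⟨a, ha, hq⟩ := hind k le_rfl
  rw [Nat.sub_self] at hq
  rw [hq, hodd.neg_pow] at h0
  have hp : 0 ≤ β ^ (k+1) := (hodd.add_one).pow_nonneg β
  have : 0 ≤ (2 * (k:ℝ) + 1) * a * β ^ (k+1) := by positivity
  rw [pow_succ] at this
  have hk0 : (0:ℝ) ≤ k := Nat.cast_nonneg k
  nlinarith
end

section
/- Let k ≥ 2 be an even natural number. Then there is exactly one pair (Q, β) with Q a monic polynomial of degree k over ℝ and β ∈ ℝ such that the polynomial Q^2 * (X + β) − X^(2k+1) − X^k has degree strictly less than k. Moreover, for this pair one has β > 0 and Q(x) > 0 for every real number x ≤ 0 (so every real root of Q is positive). -/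
open Polynomial

noncomputable def sCo (β : ℝ) (n : ℕ) : ℝ := (-β/4)^n * (Nat.centralBinom n : ℝ)

noncomputable def sSer (β : ℝ) : PowerSeries ℝ := PowerSeries.mk (sCo β)

lemma sCo_rec (β : ℝ) (n : ℕ) :
    2 * (sCo β (n+1) * ((n:ℝ)+1)) = -β * ((2*(n:ℝ)+1) * sCo β n) := by
  have h : ((n:ℝ)+1) * (Nat.centralBinom (n+1) : ℝ) = 2 * (2*(n:ℝ)+1) * Nat.centralBinom n := by
    exact_mod_cast Nat.succ_mul_centralBinom_succ n
  unfold sCo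
  rw [pow_succ]
  linear_combination 2 * (-β/4)^n * (-β/4) * h

lemma sSer_const (β : ℝ) : PowerSeries.constantCoeff (sSer β) = 1 := by
  rw [← PowerSeries.coeff_zero_eq_constantCoeff_apply, sSer, PowerSeries.coeff_mk]
  simp [sCo]

lemma sSer_ode (β : ℝ) :
    2 * PowerSeries.derivative ℝ (sSer β) * (1 + PowerSeries.C β * PowerSeries.X)
      + PowerSeries.C β * sSer β = 0 := by
  have e : 2 * PowerSeries.derivative ℝ (sSer β) * (1 + PowerSeries.C β * PowerSeries.X)
      + PowerSeries.C β * sSer β =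
      PowerSeries.C 2 * PowerSeries.derivative ℝ (sSer β) +
      PowerSeries.C (2 * β) * (PowerSeries.X * PowerSeries.derivative ℝ (sSer β))
      + PowerSeries.C β * sSer β := by
    rw [map_mul]
    have : (PowerSeries.C (2:ℝ)) = 2 := map_ofNat _ 2
    rw [this]; ring
  rw [e]
  ext n
  rcases n with _ | n
  · have := sCo_rec β 0
    simp only [map_add, PowerSeries.coeff_C_mul, PowerSeries.coeff_zero_X_mul,
      PowerSeries.coeff_derivative, sSer, PowerSeries.coeff_mk, map_zero]
    push_cast at *
    linear_combination this
  · have := sCo_rec β (n+1)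
    simp only [map_add, PowerSeries.coeff_C_mul, PowerSeries.coeff_succ_X_mul,
      PowerSeries.coeff_derivative, sSer, PowerSeries.coeff_mk, map_zero]
    push_cast at *
    linear_combination this

lemma sSer_sq (β : ℝ) :
    sSer β ^ 2 * (1 + PowerSeries.C β * PowerSeries.X) = 1 := by
  apply PowerSeries.derivative.ext
  · have h := sSer_ode β
    simp only [Derivation.leibniz, Derivation.leibniz_pow, map_add, PowerSeries.derivative_C,
      PowerSeries.derivative_X, PowerSeries.derivative_one, smul_eq_mul, nsmul_eq_mul]
    push_cast
    linear_combination sSer β * h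
  · simp [sSer_const]

lemma ps_key (β : ℝ) (k : ℕ) (q : PowerSeries ℝ) (hq : PowerSeries.constantCoeff q = 1) :
    (PowerSeries.X ^ (k+2) ∣ q^2 * (1 + PowerSeries.C β * PowerSeries.X) - 1
      - PowerSeries.X ^ (k+1)) ↔
    PowerSeries.X ^ (k+2) ∣ q - sSer β - PowerSeries.C (1/2) * PowerSeries.X ^ (k+1) := by
  set S := sSer β with hS
  set B : PowerSeries ℝ := 1 + PowerSeries.C β * PowerSeries.X with hB
  have hsq : S^2 * B = 1 := sSer_sq β
  have h1 : PowerSeries.X ∣ S * B - 1 := by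
    rw [PowerSeries.X_dvd_iff]; simp [hS, hB, sSer_const]
  obtain ⟨g, hg⟩ := h1
  have h2 : PowerSeries.C (1/2 : ℝ) * 2 = 1 := by
    have : (2 : PowerSeries ℝ) = PowerSeries.C (2:ℝ) := (map_ofNat _ 2).symm
    rw [this, ← map_mul]; norm_num
  set c : PowerSeries ℝ := PowerSeries.C (1/2 : ℝ) with hc
  have hu : IsUnit ((q + S + c * PowerSeries.X ^ (k+1)) * B) := by
    rw [PowerSeries.isUnit_iff_constantCoeff]
    simp [hq, hS, hB, sSer_const]
  have e : q^2 * B - 1 - PowerSeries.X ^ (k+1) =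
      (q - S - c * PowerSeries.X ^ (k+1)) * ((q + S + c * PowerSeries.X ^ (k+1)) * B)
      + PowerSeries.X ^ (k+2) * (g + c^2 * PowerSeries.X ^ k * B) := by
    linear_combination hsq + PowerSeries.X^(k+1) * hg + PowerSeries.X ^ (k+1) * S * B * h2
  rw [e, dvd_add_left (Dvd.intro _ rfl), hu.dvd_mul_right]

lemma poly_key (β : ℝ) (k : ℕ) (Q : ℝ[X]) (hm : Q.Monic) (hd : Q.natDegree = k) :
    (Q ^ 2 * (X + C β) - X ^ (2 * k + 1) - X ^ k).degree < (k : WithBot ℕ) ↔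
    (∀ i ≤ k, Q.coeff i = sCo β (k - i)) ∧ sCo β (k+1) = -1/2 := by
  set F := Q ^ 2 * (X + C β) - X ^ (2 * k + 1) - X ^ k with hF
  have hFd : F.natDegree ≤ 2*k+1 := by
    have h1 : (Q^2 * (X + C β)).natDegree ≤ 2*k+1 := by
      refine natDegree_mul_le.trans ?_
      have := natDegree_pow_le (p := Q) (n := 2)
      rw [natDegree_X_add_C]
      rw [hd] at this; omega
    refine (natDegree_sub_le_of_le (natDegree_sub_le_of_le h1 (natDegree_X_pow_le _))
      (natDegree_X_pow_le _)).trans ?_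
    simp; omega
  have hr : reflect (2*k+1) F = (reflect k Q)^2 * (1 + C β * X) - 1 - X^(k+1) := by
    have hQ2 : (Q*Q).natDegree ≤ k + k := natDegree_mul_le.trans (by omega)
    rw [hF, reflect_sub, reflect_sub, reflect_monomial, reflect_monomial,
      revAt_le le_rfl, revAt_le (by omega), pow_two, two_mul,
      reflect_mul (Q*Q) (X + C β) hQ2 (natDegree_X_add_C β).le,
      reflect_mul Q Q hd.le hd.le, reflect_add, reflect_one_X, reflect_C]
    have : k + k + 1 - k = k + 1 := by omega
    rw [this]; simp [pow_two]
  have h1 : F.degree < (k : WithBot ℕ) ↔ PowerSeries.X ^ (k+2) ∣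
      ((reflect (2*k+1) F : ℝ[X]) : PowerSeries ℝ) := by
    rw [PowerSeries.X_pow_dvd_iff, degree_lt_iff_coeff_zero]
    constructor
    · intro h m hm
      rw [Polynomial.coeff_coe, coeff_reflect, revAt_le (by omega)]
      exact h _ (by omega)
    · intro h m hm
      by_cases hm2 : m ≤ 2*k+1
      · have := h (2*k+1-m) (by omega)
        rw [Polynomial.coeff_coe, coeff_reflect, revAt_le (by omega)] at this
        rwa [show 2*k+1-(2*k+1-m) = m by omega] at this
      · exact coeff_eq_zero_of_natDegree_lt (by omega)
  have hq : PowerSeries.constantCoeff ((reflect k Q : ℝ[X]) : PowerSeries ℝ) = 1 := by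
    rw [← PowerSeries.coeff_zero_eq_constantCoeff_apply, Polynomial.coeff_coe, coeff_reflect,
      revAt_zero, ← hd]
    exact hm
  rw [h1, hr]
  have hcast : (((reflect k Q)^2 * (1 + C β * X) - 1 - X^(k+1) : ℝ[X]) : PowerSeries ℝ) =
      ((reflect k Q : ℝ[X]) : PowerSeries ℝ)^2 * (1 + PowerSeries.C β * PowerSeries.X) - 1
      - PowerSeries.X ^ (k+1) := by
    simp
  rw [hcast, ps_key β k _ hq, PowerSeries.X_pow_dvd_iff]
  have hco : ∀ m, PowerSeries.coeff m (((reflect k Q : ℝ[X]) : PowerSeries ℝ) - sSer β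
      - PowerSeries.C (1/2) * PowerSeries.X ^ (k+1)) =
      Q.coeff (revAt k m) - sCo β m - (if m = k+1 then 1/2 else 0) := by
    intro m
    simp [sSer, PowerSeries.coeff_X_pow]
  simp only [hco]
  have hlast : Q.coeff (revAt k (k+1)) = 0 := by
    have : revAt k (k+1) = k+1 := by
      rw [← revAtFun_eq]; simp [revAtFun]
    rw [this]
    exact coeff_eq_zero_of_natDegree_lt (by omega)
  constructor
  · intro h
    constructor
    · intro i hi
      have := h (k-i) (by omega)
      rw [revAt_le (by omega), if_neg (by omega), show k-(k-i) = i by omega] at this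
      linarith
    · have := h (k+1) (by omega)
      rw [hlast, if_pos rfl] at this
      linarith
  · rintro ⟨h, h'⟩ m hm
    by_cases hmk : m = k+1
    · subst hmk
      rw [hlast, h', if_pos rfl]; norm_num
    · rw [revAt_le (by omega), if_neg hmk, h _ (by omega), show k-(k-m) = m by omega]
      ring

lemma beta_eq (β : ℝ) (k : ℕ) (heven : Even k) (h : sCo β (k+1) = -1/2) :
    0 < β ∧ (β/4)^(k+1) = 1/(2 * (Nat.centralBinom (k+1) : ℝ)) := by
  have ho : Odd (k+1) := heven.add_one
  have hc : (0:ℝ) < Nat.centralBinom (k+1) := by exact_mod_cast Nat.centralBinom_pos _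
  have h2 : (β/4)^(k+1) = 1/(2 * (Nat.centralBinom (k+1) : ℝ)) := by
    rw [sCo, neg_div, ho.neg_pow] at h
    field_simp
    field_simp at h
    linarith
  refine ⟨?_, h2⟩
  have : 0 < (β/4)^(k+1) := by rw [h2]; positivity
  have := ho.pow_pos_iff.1 this
  linarith

theorem stmt_7 (k : ℕ) (hk : 2 ≤ k) (heven : Even k) :
    (∃! qb : Polynomial ℝ × ℝ, qb.1.Monic ∧ qb.1.natDegree = k ∧
      (qb.1 ^ 2 * (X + C qb.2) - X ^ (2 * k + 1) - X ^ k).degree < (k : WithBot ℕ)) ∧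
    ∀ (Q : Polynomial ℝ) (β : ℝ), Q.Monic → Q.natDegree = k →
      (Q ^ 2 * (X + C β) - X ^ (2 * k + 1) - X ^ k).degree < (k : WithBot ℕ) →
        0 < β ∧ ∀ x : ℝ, x ≤ 0 → 0 < Q.eval x := by
  have ho : Odd (k+1) := heven.add_one
  have hcp : ∀ n, (0:ℝ) < Nat.centralBinom n := fun n => by
    exact_mod_cast Nat.centralBinom_pos _
  constructor
  · obtain ⟨β, hβ⟩ : ∃ β : ℝ, sCo β (k+1) = -1/2 := by
      have hc := hcp (k+1)
      refine ⟨4 * (1/(2 * (Nat.centralBinom (k+1) : ℝ)))^(((k+1 : ℕ) : ℝ)⁻¹), ?_⟩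
      rw [sCo, neg_div, mul_div_cancel_left₀ _ (by norm_num), ho.neg_pow,
        Real.rpow_inv_natCast_pow (by positivity) (by omega)]
      field_simp
    set Q : ℝ[X] := ∑ i ∈ Finset.range (k+1), C (sCo β (k-i)) * X^i with hQ
    have hco : ∀ i, Q.coeff i = if i ≤ k then sCo β (k-i) else 0 := by
      intro i
      simp [hQ, coeff_X_pow]
    have hQk : Q.coeff k = 1 := by rw [hco]; simp [sCo]
    have hle : Q.natDegree ≤ k := by
      rw [natDegree_le_iff_coeff_eq_zero]
      intro i hi
      rw [hco, if_neg (by omega)]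
    have hd : Q.natDegree = k :=
      le_antisymm hle (le_natDegree_of_ne_zero (by rw [hQk]; norm_num))
    have hm : Q.Monic := monic_of_natDegree_le_of_coeff_eq_one k hle hQk
    refine ⟨(Q, β), ⟨hm, hd, (poly_key β k Q hm hd).2 ⟨fun i hi => ?_, hβ⟩⟩, ?_⟩
    · rw [hco, if_pos hi]
    · rintro ⟨Q', β'⟩ ⟨hm', hd', h'⟩
      simp only at hm' hd' h'
      obtain ⟨h1, h2⟩ := (poly_key β' k Q' hm' hd').1 h'
      have hb : β' = β := by
        have := ho.strictMono_pow.injective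
          ((beta_eq β' k heven h2).2.trans (beta_eq β k heven hβ).2.symm)
        linarith
      subst hb
      have : Q' = Q := by
        ext i
        rw [hco]
        split_ifs with hi
        · exact h1 i hi
        · exact coeff_eq_zero_of_natDegree_lt (by omega)
      rw [this]
  · intro Q β hm hd h
    obtain ⟨h1, h2⟩ := (poly_key β k Q hm hd).1 h
    obtain ⟨hb, -⟩ := beta_eq β k heven h2
    refine ⟨hb, fun x hx => ?_⟩
    have ht : ∀ i ∈ Finset.range (k+1), Q.coeff i * x^i =
        (β/4)^(k-i) * (-x)^i * (Nat.centralBinom (k-i) : ℝ) := by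
      intro i hi
      have hi : i ≤ k := by simpa [Nat.lt_succ_iff] using hi
      rw [h1 i hi, sCo]
      have e1 : (-β/4)^(k-i) = (-1)^(k-i) * (β/4)^(k-i) := by rw [← mul_pow]; ring
      have e2 : x^i = (-1)^i * (-x)^i := by rw [← mul_pow]; ring
      have e3 : (-1:ℝ)^(k-i) * (-1)^i = 1 := by
        rw [← pow_add, Nat.sub_add_cancel hi, heven.neg_one_pow]
      rw [e1, e2]
      linear_combination (β/4)^(k-i) * (-x)^i * (Nat.centralBinom (k-i) : ℝ) * e3
    rw [eval_eq_sum_range, hd, Finset.sum_congr rfl ht]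
    have hx' : 0 ≤ -x := by linarith
    apply Finset.sum_pos'
    · intro i _
      positivity
    · refine ⟨0, by simp, ?_⟩
      have := hcp k
      simp only [pow_zero, Nat.sub_zero]
      positivity
end

section
/- Let k ≥ 1 be a natural number, let P, Q be polynomials over ℂ with degree of P at most k and Q monic of degree k − 1, and let β ∈ ℂ. If X^(2k+1) + X^(k+1) + P = Q^2 * (X + β)^3, then (2k+1) • ((X+β) * Q) − 3 • (X * Q) − 2 • (X * (X+β) * (derivative Q)) equals the constant polynomial k. -/
open Polynomial

theorem stmt_8 (k : ℕ) (hk : 1 ≤ k) (P Q : Polynomial ℂ) (β : ℂ)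
    (hP : P.degree ≤ (k : WithBot ℕ))
    (hQmonic : Q.Monic) (hQdeg : Q.natDegree = k - 1)
    (heq : X ^ (2 * k + 1) + X ^ (k + 1) + P = Q ^ 2 * (X + C β) ^ 3) :
    (2 * k + 1) • ((X + C β) * Q) - 3 • (X * Q) - 2 • (X * (X + C β) * derivative Q)
      = C (k : ℂ) := by
  have hd := congrArg derivative heq
  simp only [derivative_add, derivative_mul, derivative_X_pow, derivative_pow, derivative_X,
    derivative_C] at hd
  set R := (2 * k + 1) • ((X + C β) * Q) - 3 • (X * Q) - 2 • (X * (X + C β) * derivative Q)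
    with hR
  have hM : (Q * (X + C β) ^ 2).Monic := hQmonic.mul ((monic_X_add_C β).pow 2)
  have hMd : (Q * (X + C β) ^ 2).natDegree = k + 1 := by
    rw [hQmonic.natDegree_mul ((monic_X_add_C β).pow 2), hQdeg, (monic_X_add_C β).natDegree_pow,
      natDegree_X_add_C]
    omega
  have key : (Q * (X + C β) ^ 2) * (R - C (k : ℂ)) =
      C (k : ℂ) * (X ^ (k + 1) - Q * (X + C β) ^ 2) + C (2 * k + 1 : ℂ) * P
        - X * derivative P := by
    rw [hR]
    simp only [nsmul_eq_mul, map_add, map_mul, map_natCast, map_one, map_ofNat] at hd ⊢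
    push_cast at hd ⊢
    simp only [Nat.add_sub_cancel, pow_succ, map_add, map_mul, map_natCast, map_one, map_ofNat] at hd heq ⊢
    linear_combination (-(2 * (k : ℂ[X]) + 1)) * heq + X * hd
  by_contra hne
  have hne' : R - C (k : ℂ) ≠ 0 := sub_ne_zero.mpr hne
  have hPc : ∀ m, k + 1 ≤ m → P.coeff m = 0 := fun m hm =>
    coeff_eq_zero_of_degree_lt (lt_of_le_of_lt hP (by exact_mod_cast hm))
  have hz : ∀ m, k + 1 ≤ m → (C (k : ℂ) * (X ^ (k + 1) - Q * (X + C β) ^ 2)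
      + C (2 * k + 1 : ℂ) * P - X * derivative P).coeff m = 0 := by
    intro m hm
    have h1 : (X ^ (k + 1) - Q * (X + C β) ^ 2 : ℂ[X]).coeff m = 0 := by
      rcases hm.eq_or_lt with h | h
      · have := hM.coeff_natDegree
        rw [hMd] at this
        rw [← h, coeff_sub, this]; simp
      · rw [coeff_sub, coeff_eq_zero_of_natDegree_lt (p := Q * (X + C β) ^ 2) (by omega),
          coeff_X_pow]
        simp; omega
    obtain ⟨n, rfl⟩ : ∃ n, m = n + 1 := ⟨m - 1, by omega⟩
    rw [coeff_sub, coeff_add, coeff_C_mul, coeff_C_mul, h1, coeff_X_mul, coeff_derivative,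
      hPc _ hm]
    simp
  have h2 := hz ((Q * (X + C β) ^ 2) * (R - C (k : ℂ))).natDegree (by
    rw [hM.natDegree_mul' hne', hMd]; omega)
  rw [← key] at h2
  exact mul_ne_zero hM.ne_zero hne' (leadingCoeff_eq_zero.mp h2)
end

section
/- Let k ≥ 1 be a natural number, let Q be a monic polynomial of degree k − 1 over ℂ and β ∈ ℂ, and suppose (2k+1) • ((X+β) * Q) − 3 • (X * Q) − 2 • (X * (X+β) * (derivative Q)) equals the constant polynomial k. Then the polynomial Q^2 * (X + β)^3 − X^(2k+1) − X^(k+1) has degree at most k; equivalently, X^(2k+1) + X^(k+1) + P = Q^2 (X+β)^3 for a (unique) polynomial P of degree at most k. -/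
open Polynomial

theorem stmt_9 (k : ℕ) (hk : 1 ≤ k) (Q : Polynomial ℂ) (β : ℂ)
    (hQmonic : Q.Monic) (hQdeg : Q.natDegree = k - 1)
    (hid : (2 * k + 1) • ((X + C β) * Q) - 3 • (X * Q) - 2 • (X * (X + C β) * derivative Q)
      = C (k : ℂ)) :
    (Q ^ 2 * (X + C β) ^ 3 - X ^ (2 * k + 1) - X ^ (k + 1)).degree ≤ (k : WithBot ℕ) := by
  have hL : (X + C β : ℂ[X]).Monic := monic_X_add_C β
  have hF : (Q ^ 2 * (X + C β) ^ 3).Monic := (hQmonic.pow 2).mul (hL.pow 3)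
  have hFd : (Q ^ 2 * (X + C β) ^ 3).natDegree = 2 * k + 1 := by
    rw [(hQmonic.pow 2).natDegree_mul (hL.pow 3), hQmonic.natDegree_pow, hL.natDegree_pow,
      natDegree_X_add_C, hQdeg]
    omega
  have hG : (Q * (X + C β) ^ 2).Monic := hQmonic.mul (hL.pow 2)
  have hGd : (Q * (X + C β) ^ 2).natDegree = k + 1 := by
    rw [hQmonic.natDegree_mul (hL.pow 2), hL.natDegree_pow, natDegree_X_add_C, hQdeg]
    omega
  have key : C (2 * (k : ℂ) + 1) * (Q ^ 2 * (X + C β) ^ 3)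
      - X * derivative (Q ^ 2 * (X + C β) ^ 3) = C (k : ℂ) * (Q * (X + C β) ^ 2) := by
    rw [← hid]
    simp only [derivative_mul, derivative_pow, derivative_add, derivative_X, derivative_C,
      nsmul_eq_mul]
    have e2 : (C 2 : ℂ[X]) = 2 := rfl
    have e3 : (C 3 : ℂ[X]) = 3 := rfl
    simp [e2, e3]
    ring
  generalize Q ^ 2 * (X + C β) ^ 3 = F at *
  generalize Q * (X + C β) ^ 2 = G at *
  have hc : ∀ n : ℕ, (2 * (k : ℂ) + 1 - (n + 1 : ℕ)) * F.coeff (n + 1)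
      = k * G.coeff (n + 1) := by
    intro n
    have := congrArg (fun p => p.coeff (n + 1)) key
    simp only [coeff_sub, coeff_C_mul, coeff_X_mul, coeff_derivative] at this
    rw [← this]
    push_cast
    ring
  rw [degree_le_iff_coeff_zero]
  intro m hm
  have hm : k < m := by exact_mod_cast hm
  obtain ⟨n, rfl⟩ : ∃ n, m = n + 1 := ⟨m - 1, by omega⟩
  have hk0 : (k : ℂ) ≠ 0 := by exact_mod_cast (by omega : k ≠ 0)
  simp only [coeff_sub, coeff_X_pow]
  by_cases h1 : n + 1 = 2 * k + 1
  · have h2 : F.coeff (n + 1) = 1 := by rw [h1, ← hFd]; exact hF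
    rw [h2, if_pos h1, if_neg (by omega)]
    ring
  · by_cases h3 : n + 1 = k + 1
    · have h2 : G.coeff (n + 1) = 1 := by rw [h3, ← hGd]; exact hG
      have h4 := hc n
      rw [h2, h3] at h4
      rw [if_neg h1, if_pos h3, h3]
      have h5 : (k : ℂ) * (F.coeff (k + 1) - 1) = 0 := by
        push_cast at h4
        linear_combination h4
      rcases mul_eq_zero.1 h5 with h | h
      · exact absurd h hk0
      · linear_combination h
    · have h2 : G.coeff (n + 1) = 0 := coeff_eq_zero_of_natDegree_lt (by omega)
      have h4 := hc n
      rw [h2, mul_zero] at h4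
      rw [if_neg h1, if_neg h3]
      rcases mul_eq_zero.1 h4 with h | h
      · exfalso
        apply h1
        have := sub_eq_zero.1 h
        exact_mod_cast this.symm
      · rw [h]; ring
end

section
/- For every natural number k ≥ 1, the set of pairs (Q, β) with Q a monic polynomial of degree k − 1 over ℂ and β ∈ ℂ, such that the polynomial Q^2 * (X + β)^3 − X^(2k+1) − X^(k+1) has degree at most k, is finite of cardinality exactly k. -/
open Polynomial

namespace EC

noncomputable def F : PowerSeries ℂ := PowerSeries.binomialSeries ℂ (-3/2 : ℂ)

noncomputable def c (n : ℕ) : ℂ := PowerSeries.coeff n F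

lemma F_sq : F ^ 2 * (1 + PowerSeries.X) ^ 3 = 1 := by
  have h := PowerSeries.binomialSeries_nat (R := ℂ) (A := ℂ) 3
  rw [← h, F, sq, ← PowerSeries.binomialSeries_add, ← PowerSeries.binomialSeries_add,
    ← PowerSeries.binomialSeries_zero (R := ℂ) (A := ℂ)]
  congr 1
  push_cast
  norm_num

lemma c_zero : c 0 = 1 := by simp [c, F]

lemma c_ne (n : ℕ) : c n ≠ 0 := by
  have h := Ring.descPochhammer_eq_factorial_smul_choose (-3/2 : ℂ) n
  rw [← Polynomial.aeval_eq_smeval, Polynomial.aeval_def, ← Polynomial.eval_map,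
    descPochhammer_map, descPochhammer_eval_eq_prod_range] at h
  intro h0
  have h1 : Ring.choose (-3/2 : ℂ) n = 0 := by simpa [c, F] using h0
  rw [h1, smul_zero, Finset.prod_eq_zero_iff] at h
  obtain ⟨j, -, hj⟩ := h
  have : ((-3/2 - j : ℝ) : ℂ) = 0 := by push_cast; exact hj
  rw [Complex.ofReal_eq_zero] at this
  have hj0 : (0:ℝ) ≤ j := Nat.cast_nonneg j
  linarith

noncomputable def H (k : ℕ) (β : ℂ) : PowerSeries ℂ :=
  PowerSeries.rescale β F * (1 + PowerSeries.C (1/2) * PowerSeries.X ^ k)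

lemma coeff_H (k : ℕ) (β : ℂ) (n : ℕ) (hn : n ≤ k) :
    PowerSeries.coeff n (H k β) = c n * β ^ n + if n = k then 1/2 else 0 := by
  have e : H k β = PowerSeries.rescale β F
      + PowerSeries.C (1/2) * (PowerSeries.rescale β F * PowerSeries.X ^ k) := by
    rw [H]; ring
  rw [e, map_add, PowerSeries.coeff_rescale, PowerSeries.coeff_C_mul,
    PowerSeries.coeff_mul_X_pow']
  have h0 : PowerSeries.coeff 0 (PowerSeries.rescale β F) = 1 := by
    rw [PowerSeries.coeff_rescale]; simpa [c] using c_zero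
  rcases eq_or_lt_of_le hn with h | h
  · subst h
    simp only [le_refl, if_true, Nat.sub_self, h0, c]; ring
  · simp only [not_le.2 h, h.ne, if_false, c]; ring

lemma key_ps (k : ℕ) (hk : 1 ≤ k) (β : ℂ) (q : PowerSeries ℂ)
    (hq : PowerSeries.constantCoeff q = 1) :
    PowerSeries.X ^ (k+1) ∣ q ^ 2 * (1 + PowerSeries.C β * PowerSeries.X) ^ 3 - 1
      - PowerSeries.X ^ k ↔ PowerSeries.X ^ (k+1) ∣ q - H k β := by
  set u : PowerSeries ℂ := (1 + PowerSeries.C β * PowerSeries.X) ^ 3 with hu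
  have hG : (PowerSeries.rescale β F) ^ 2 * u = 1 := by
    have := congrArg (PowerSeries.rescale β) F_sq
    simpa [PowerSeries.rescale_X] using this
  have hh : (PowerSeries.C (1/2 : ℂ)) * 2 = 1 := by
    have : (2 : PowerSeries ℂ) = PowerSeries.C 2 := (map_ofNat _ 2).symm
    rw [this, ← map_mul]; norm_num
  have e : q ^ 2 * u - 1 - PowerSeries.X ^ k = (q - H k β) * ((q + H k β) * u)
      + PowerSeries.X ^ (k+1) * (PowerSeries.C (1/2) ^ 2 * PowerSeries.X ^ (k - 1)) := by
    have e1 : PowerSeries.X ^ (k+1) * (PowerSeries.C (1/2 : ℂ) ^ 2 * PowerSeries.X ^ (k - 1))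
        = PowerSeries.C (1/2 : ℂ) ^ 2 * PowerSeries.X ^ k * PowerSeries.X ^ k := by
      obtain ⟨m, rfl⟩ : ∃ m, k = m + 1 := ⟨k - 1, by omega⟩
      simp only [Nat.add_sub_cancel]; ring
    rw [e1, H]
    linear_combination (1 + PowerSeries.C (1/2) * PowerSeries.X ^ k) ^ 2 * hG
      + PowerSeries.X ^ k * hh
  have hU : IsUnit ((q + H k β) * u) := by
    rw [PowerSeries.isUnit_iff_constantCoeff]
    have h0 : PowerSeries.constantCoeff (H k β) = 1 := by
      rw [← PowerSeries.coeff_zero_eq_constantCoeff_apply, coeff_H _ _ _ (Nat.zero_le _)]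
      rw [if_neg (by omega), c_zero]; simp
    simp [hq, h0, hu]
  rw [e, dvd_add_left (dvd_mul_right _ _), hU.dvd_mul_right]

lemma key_poly (m : ℕ) (β : ℂ) (Q : ℂ[X]) (hQ : Q.natDegree ≤ m) (hQ1 : Q.coeff m = 1) :
    (Q ^ 2 * (X + C β) ^ 3 - X ^ (2 * (m+1) + 1) - X ^ (m + 1 + 1)).degree
        ≤ ((m + 1 : ℕ) : WithBot ℕ) ↔
    ∀ n ≤ m + 1, (reflect m Q).coeff n = c n * β ^ n + if n = m + 1 then 1/2 else 0 := by
  set P := Q ^ 2 * (X + C β) ^ 3 - X ^ (2 * (m+1) + 1) - X ^ (m + 1 + 1) with hP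
  have hX : (X + C β).natDegree ≤ 1 := by simp
  have h2 : (Q * Q).natDegree ≤ m + m := natDegree_mul_le_of_le hQ hQ
  have h3 : ((X + C β) * (X + C β)).natDegree ≤ 1 + 1 := natDegree_mul_le_of_le hX hX
  have h4 : ((X + C β) * (X + C β) * (X + C β)).natDegree ≤ 1 + 1 + 1 :=
    natDegree_mul_le_of_le h3 hX
  have hrX : reflect 1 (X + C β) = 1 + C β * X := by
    rw [reflect_add, reflect_one_X, reflect_C, pow_one]
  have hr : reflect (2 * (m+1) + 1) P
      = (reflect m Q) ^ 2 * (1 + C β * X) ^ 3 - 1 - X ^ (m+1) := by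
    rw [hP, reflect_sub, reflect_sub, reflect_monomial, reflect_monomial,
      revAt_le le_rfl, revAt_le (by omega)]
    have a1 : 2 * (m+1) + 1 = (m + m) + (1 + 1 + 1) := by ring
    have a2 : 2 * (m+1) + 1 - (m + 1 + 1) = m + 1 := by omega
    have a3 : Q ^ 2 * (X + C β) ^ 3 = (Q * Q) * ((X + C β) * (X + C β) * (X + C β)) := by ring
    rw [a2, Nat.sub_self, a3, a1, reflect_mul _ _ h2 h4, reflect_mul _ _ hQ hQ,
      reflect_mul _ _ h3 hX, reflect_mul _ _ hX hX, hrX]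
    ring
  have hPd : P.natDegree ≤ 2 * (m+1) + 1 := by
    have b1 : (Q ^ 2 * (X + C β) ^ 3).natDegree ≤ 2 * (m+1) + 1 := by
      have a3 : Q ^ 2 * (X + C β) ^ 3 = (Q * Q) * ((X + C β) * (X + C β) * (X + C β)) := by ring
      rw [a3]
      exact (natDegree_mul_le_of_le h2 h4).trans (by omega)
    have b2 : (X ^ (2 * (m+1) + 1) : ℂ[X]).natDegree ≤ 2 * (m+1) + 1 := by simp
    have b3 : (X ^ (m + 1 + 1) : ℂ[X]).natDegree ≤ m + 1 + 1 := by simp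
    exact (natDegree_sub_le_of_le (natDegree_sub_le_of_le b1 b2) b3).trans (by omega)
  have hdeg : P.degree ≤ ((m + 1 : ℕ) : WithBot ℕ) ↔
      ∀ n < m + 1 + 1, (reflect (2 * (m+1) + 1) P).coeff n = 0 := by
    rw [degree_le_iff_coeff_zero]
    constructor
    · intro h n hn
      rw [coeff_reflect, revAt_le (by omega)]
      exact h _ (by norm_cast; omega)
    · intro h n hn
      have hn' : m + 1 < n := by exact_mod_cast hn
      by_cases hb : n ≤ 2 * (m+1) + 1
      · have := h (2 * (m+1) + 1 - n) (by omega)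
        rw [coeff_reflect, revAt_le (by omega)] at this
        rwa [Nat.sub_sub_self hb] at this
      · exact coeff_eq_zero_of_natDegree_lt (by omega)
  have hq : PowerSeries.constantCoeff (reflect m Q : PowerSeries ℂ) = 1 := by
    rw [← PowerSeries.coeff_zero_eq_constantCoeff_apply, Polynomial.coeff_coe, coeff_reflect,
      revAt_le (Nat.zero_le _)]
    simpa using hQ1
  have hk := key_ps (m+1) (by omega) β (reflect m Q) hq
  rw [hdeg, hr]
  have hc : (((reflect m Q) ^ 2 * (1 + C β * X) ^ 3 - 1 - X ^ (m+1) : ℂ[X]) : PowerSeries ℂ)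
      = (reflect m Q : PowerSeries ℂ) ^ 2 * (1 + PowerSeries.C β * PowerSeries.X) ^ 3 - 1
      - PowerSeries.X ^ (m+1) := by
    simp
  rw [← hc, PowerSeries.X_pow_dvd_iff, PowerSeries.X_pow_dvd_iff] at hk
  simp only [Polynomial.coeff_coe] at hk
  rw [hk]
  refine forall_congr' fun n => ?_
  rw [Nat.lt_succ_iff]
  refine forall_congr' fun hn => ?_
  rw [map_sub, coeff_H _ _ _ hn, Polynomial.coeff_coe, sub_eq_zero]

noncomputable def Qs (m : ℕ) (β : ℂ) : ℂ[X] :=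
  reflect m (∑ i ∈ Finset.range (m+1), C (c i * β ^ i) * X ^ i)

lemma coeff_refl_Qs (m : ℕ) (β : ℂ) (n : ℕ) :
    (reflect m (Qs m β)).coeff n = if n < m + 1 then c n * β ^ n else 0 := by
  rw [Qs, reflect_reflect, finsetSum_coeff]
  simp only [coeff_C_mul_X_pow]
  rw [Finset.sum_ite_eq]
  simp only [Finset.mem_range]

lemma coeff_of_refl (m : ℕ) (Q : ℂ[X]) (n : ℕ) :
    Q.coeff n = (reflect m Q).coeff (revAt m n) := by
  rw [coeff_reflect, revAt_invol]

lemma Qs_deg (m : ℕ) (β : ℂ) : (Qs m β).natDegree ≤ m := by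
  rw [natDegree_le_iff_coeff_eq_zero]
  intro n hn
  rw [coeff_of_refl m, coeff_refl_Qs, revAt_eq_self_of_lt hn, if_neg (by omega)]

lemma Qs_coeff (m : ℕ) (β : ℂ) : (Qs m β).coeff m = 1 := by
  rw [coeff_of_refl m, coeff_refl_Qs, revAt_le le_rfl, if_pos (by omega)]
  simp [c_zero]

lemma mem_iff (m : ℕ) (Q : ℂ[X]) (β : ℂ) :
    (Q.Monic ∧ Q.natDegree = m ∧
      (Q ^ 2 * (X + C β) ^ 3 - X ^ (2 * (m+1) + 1) - X ^ (m + 1 + 1)).degree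
        ≤ ((m + 1 : ℕ) : WithBot ℕ)) ↔ c (m+1) * β ^ (m+1) + 1/2 = 0 ∧ Qs m β = Q := by
  constructor
  · rintro ⟨h1, h2, h3⟩
    have h4 : Q.coeff m = 1 := by rw [← h2]; exact h1
    rw [key_poly m β Q h2.le h4] at h3
    have hz : ∀ n, m < n → (reflect m Q).coeff n = 0 := by
      intro n hn
      rw [coeff_reflect, revAt_eq_self_of_lt hn]
      exact coeff_eq_zero_of_natDegree_lt (by omega)
    refine ⟨?_, ?_⟩
    · have := h3 (m+1) le_rfl
      rw [hz _ (by omega), if_pos rfl] at this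
      exact this.symm
    · rw [← reflect_reflect (N := m) (p := Qs m β), ← reflect_reflect (N := m) (p := Q)]
      congr 1
      ext n
      rw [coeff_refl_Qs]
      split_ifs with hn
      · rw [h3 n (by omega), if_neg (by omega), add_zero]
      · rw [hz n (by omega)]
  · rintro ⟨h1, rfl⟩
    have hd : (Qs m β).natDegree = m :=
      le_antisymm (Qs_deg m β) (le_natDegree_of_ne_zero (by rw [Qs_coeff]; simp))
    refine ⟨?_, hd, ?_⟩
    · rw [Monic, leadingCoeff, hd, Qs_coeff]
    · rw [key_poly m β _ (Qs_deg m β) (Qs_coeff m β)]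
      intro n hn
      rw [coeff_refl_Qs]
      rcases eq_or_lt_of_le hn with h | h
      · rw [if_neg (by omega), if_pos h, h, h1]
      · rw [if_pos h, if_neg (by omega), add_zero]

lemma roots_card (k : ℕ) (hk : 1 ≤ k) (d : ℂ) (hd : d ≠ 0) :
    {β : ℂ | β ^ k = d}.Finite ∧ {β : ℂ | β ^ k = d}.ncard = k := by
  have hs : (X ^ k - C d : ℂ[X]).Separable :=
    separable_X_pow_sub_C d (by exact_mod_cast (by omega : k ≠ 0)) hd
  have hne : (X ^ k - C d : ℂ[X]) ≠ 0 := hs.ne_zero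
  have e : {β : ℂ | β ^ k = d} = ((X ^ k - C d : ℂ[X]).roots.toFinset : Set ℂ) := by
    ext β
    simp [hne, sub_eq_zero]
  rw [e]
  refine ⟨Finset.finite_toSet _, ?_⟩
  rw [Set.ncard_coe_finset, Multiset.toFinset_card_of_nodup (nodup_roots hs),
    ← (IsAlgClosed.splits _).natDegree_eq_card_roots, natDegree_X_pow_sub_C]

end EC

theorem stmt_10 (k : ℕ) (hk : 1 ≤ k) :
    {qb : Polynomial ℂ × ℂ | qb.1.Monic ∧ qb.1.natDegree = k - 1 ∧
      (qb.1 ^ 2 * (X + C qb.2) ^ 3 - X ^ (2 * k + 1) - X ^ (k + 1)).degree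
        ≤ (k : WithBot ℕ)}.Finite ∧
    {qb : Polynomial ℂ × ℂ | qb.1.Monic ∧ qb.1.natDegree = k - 1 ∧
      (qb.1 ^ 2 * (X + C qb.2) ^ 3 - X ^ (2 * k + 1) - X ^ (k + 1)).degree
        ≤ (k : WithBot ℕ)}.ncard = k := by
  obtain ⟨m, rfl⟩ : ∃ m, k = m + 1 := ⟨k - 1, by omega⟩
  have hc := EC.c_ne (m+1)
  have hd : -(1/2) / EC.c (m+1) ≠ 0 := div_ne_zero (by norm_num) hc
  have e : {qb : Polynomial ℂ × ℂ | qb.1.Monic ∧ qb.1.natDegree = m + 1 - 1 ∧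
      (qb.1 ^ 2 * (X + C qb.2) ^ 3 - X ^ (2 * (m + 1) + 1) - X ^ (m + 1 + 1)).degree
        ≤ ((m + 1 : ℕ) : WithBot ℕ)} =
      (fun β => (EC.Qs m β, β)) '' {β : ℂ | β ^ (m+1) = -(1/2) / EC.c (m+1)} := by
    ext ⟨Q, β⟩
    have h := EC.mem_iff m Q β
    simp only [Set.mem_ofPred_eq, Nat.add_sub_cancel, Set.mem_image, Prod.mk.injEq]
    rw [h]
    have h' : EC.c (m+1) * β ^ (m+1) + 1/2 = 0 ↔ β ^ (m+1) = -(1/2) / EC.c (m+1) := by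
      rw [eq_div_iff hc, mul_comm, eq_neg_iff_add_eq_zero]
    rw [h']
    constructor
    · rintro ⟨a, b⟩
      exact ⟨β, a, b, rfl⟩
    · rintro ⟨b, a, h1, rfl⟩
      exact ⟨a, h1⟩
  obtain ⟨hf, hn⟩ := EC.roots_card (m+1) hk _ hd
  rw [e]
  refine ⟨hf.image _, ?_⟩
  rw [Set.ncard_image_of_injective _ (fun a b h => (Prod.mk.inj h).2), hn]
end

section
/- Let k ≥ 2 be an even natural number. Then there is no pair (Q, β) with Q a monic polynomial of degree k − 1 over ℝ and β ∈ ℝ such that the polynomial Q^2 * (X + β)^3 − X^(2k+1) − X^(k+1) has degree at most k. -/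
open Polynomial

theorem stmt_11 (k : ℕ) (hk : 2 ≤ k) (heven : Even k) :
    ¬ ∃ (Q : Polynomial ℝ) (β : ℝ), Q.Monic ∧ Q.natDegree = k - 1 ∧
      (Q ^ 2 * (X + C β) ^ 3 - X ^ (2 * k + 1) - X ^ (k + 1)).degree ≤ (k : WithBot ℕ) := by
  rintro ⟨Q, β, hQ, hd, hE⟩
  obtain ⟨j, rfl⟩ : ∃ j, k = j + 1 := ⟨k - 1, by omega⟩
  simp only [Nat.add_sub_cancel] at hd
  set E := Q ^ 2 * (X + C β) ^ 3 - X ^ (2 * (j+1) + 1) - X ^ ((j+1) + 1) with hEdef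
  have hEn : E.natDegree ≤ j + 1 := natDegree_le_iff_degree_le.mpr hE
  have hL : (X + C β : ℝ[X]).Monic := monic_X_add_C β
  have hM : (Q * (X + C β) ^ 2).Monic := hQ.mul (hL.pow 2)
  have hMd : (Q * (X + C β) ^ 2).natDegree = j + 2 := by
    rw [hQ.natDegree_mul (hL.pow 2), hL.natDegree_pow, natDegree_X_add_C, hd]
  set M := Q * (X + C β) ^ 2 with hMdef
  set H := C (2 * (j:ℝ)) * (X * Q) + C ((2 * j + 3) * β) * Q
    - C 2 * (X * (X * derivative Q)) - C (2 * β) * (X * derivative Q) with hH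
  have key : M * (H - C ((j:ℝ) + 1)) = C (2 * (j:ℝ) + 3) * E - X * derivative E
      - C ((j:ℝ)+1) * (M - X ^ (j + 2)) := by
    have hdE : derivative E = 2 * Q * derivative Q * (X + C β) ^ 3 + Q ^ 2 * (3 * (X + C β) ^ 2)
        - (2 * C (j:ℝ) + 3) * X ^ (2 * j + 2) - (C (j:ℝ) + 2) * X ^ (j + 1) := by
      rw [hEdef]
      simp only [derivative_sub, derivative_mul, derivative_pow, derivative_X_pow, derivative_add,
        derivative_X, derivative_C, Nat.add_sub_cancel]
      simp only [map_natCast, Nat.cast_add, Nat.cast_mul, Nat.cast_one, Nat.cast_ofNat, map_add,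
        map_mul, map_one, map_ofNat]
      ring
    rw [hdE, hH, hMdef, hEdef]
    simp only [map_add, map_mul, map_one, map_ofNat]
    ring
  have hH0 : H = C ((j:ℝ) + 1) := by
    by_contra hne
    have hne' : H - C ((j:ℝ) + 1) ≠ 0 := sub_ne_zero.mpr hne
    have h1 := hM.natDegree_mul' hne'
    have h2 : (M * (H - C ((j:ℝ) + 1))).natDegree ≤ j + 1 := by
      rw [key, natDegree_le_iff_coeff_eq_zero]
      intro N hN
      obtain ⟨n, rfl⟩ : ∃ n, N = n + 1 := ⟨N - 1, by omega⟩
      have e1 : E.coeff (n+1) = 0 := coeff_eq_zero_of_natDegree_lt (by omega)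
      have e2 : M.coeff (n+1) = if n + 1 = j + 2 then 1 else 0 := by
        split_ifs with h
        · rw [h, ← hMd]; exact hM
        · exact coeff_eq_zero_of_natDegree_lt (by omega)
      simp only [coeff_sub, coeff_C_mul, coeff_X_mul, coeff_derivative, e1, e2, coeff_X_pow]
      simp
    omega
  have c0 : (2 * (j:ℝ) + 3) * β * Q.coeff 0 = j + 1 := by
    have := congrArg (fun p => coeff p 0) hH0
    simpa [hH, mul_coeff_zero] using this
  have cn : ∀ n : ℕ, (2 * (j:ℝ) - 2 * n) * Q.coeff n
      + (2 * j + 1 - 2 * n) * β * Q.coeff (n + 1) = 0 := by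
    intro n
    have h := congrArg (fun p => coeff p (n+1)) hH0
    rcases n with _ | n
    · simp only [hH, coeff_sub, coeff_add, coeff_C_mul, coeff_X_mul, coeff_derivative, coeff_C,
        mul_coeff_zero, coeff_X_zero] at h
      simp at h ⊢
      linarith
    · simp only [hH, coeff_sub, coeff_add, coeff_C_mul, coeff_X_mul, coeff_derivative, coeff_C] at h
      simp at h ⊢
      linarith
  have ind : ∀ m n : ℕ, n + m = j → ∃ c : ℝ, 0 < c ∧ Q.coeff n = c * (-β) ^ m := by
    intro m
    induction m with
    | zero =>
      intro n hn
      refine ⟨1, one_pos, ?_⟩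
      have : n = Q.natDegree := by omega
      rw [this]; simpa using hQ.leadingCoeff
    | succ m ih =>
      intro n hn
      obtain ⟨c, hc, h⟩ := ih (n+1) (by omega)
      have hj : (j:ℝ) = n + m + 1 := by rw [← hn]; push_cast; ring
      have h2 := cn n
      rw [h, hj] at h2
      refine ⟨(2 * m + 3) / (2 * m + 2) * c, by positivity, ?_⟩
      have : (2 * (m:ℝ) + 2) ≠ 0 := by positivity
      field_simp
      rw [pow_succ]
      linear_combination h2
  obtain ⟨c, hc, h⟩ := ind j 0 (by omega)
  have hp : 0 ≤ (-β) ^ (j + 1) := heven.pow_nonneg _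
  rw [h] at c0
  have : (2 * (j:ℝ) + 3) * β * (c * (-β) ^ j) = -((2 * (j:ℝ) + 3) * c * (-β) ^ (j+1)) := by
    ring
  have h3 : 0 ≤ (2 * (j:ℝ) + 3) * c * (-β) ^ (j+1) := by positivity
  have : (0:ℝ) ≤ j := by positivity
  linarith
end

section
/- Let k ≥ 1 be an odd natural number. Then there is exactly one pair (Q, β) with Q a monic polynomial of degree k − 1 over ℝ and β ∈ ℝ such that the polynomial Q^2 * (X + β)^3 − X^(2k+1) − X^(k+1) has degree at most k; moreover, for this pair one has β > 0. -/
open Polynomial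

lemma aux_sign (n : ℕ) : 0 < (-1:ℝ)^n * Ring.choose (-3/2 : ℝ) n := by
  have h : ∀ n : ℕ, 0 < (-1:ℝ)^n * (descPochhammer ℤ n).smeval (-3/2 : ℝ) := by
    intro n
    induction n with
    | zero => simp
    | succ n ih =>
      have : (descPochhammer ℤ (n+1)).smeval (-3/2 : ℝ)
          = (descPochhammer ℤ n).smeval (-3/2 : ℝ) * (-3/2 - n) := by
        simp [descPochhammer_succ_right, Polynomial.smeval_mul, Polynomial.smeval_natCast]
      rw [this, pow_succ]
      have h2 : (0:ℝ) < 3/2 + n := by positivity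
      have := mul_pos ih h2
      nlinarith
  have h1 := h n
  rw [Ring.descPochhammer_eq_factorial_smul_choose, nsmul_eq_mul] at h1
  have h2 : (0:ℝ) < n.factorial := by positivity
  have h3 : 0 < (n.factorial : ℝ) * ((-1:ℝ)^n * Ring.choose (-3/2 : ℝ) n) := by linarith
  exact (mul_pos_iff_of_pos_left h2).1 h3

noncomputable def auxU (β : ℝ) : PowerSeries ℝ :=
  PowerSeries.rescale β (PowerSeries.binomialSeries ℝ (-3/2 : ℝ))

lemma auxU_eq (β : ℝ) : auxU β ^ 2 * (1 + PowerSeries.C β * PowerSeries.X) ^ 3 = 1 := by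
  have h : PowerSeries.binomialSeries ℝ (-3/2 : ℝ) ^ 2 * (1 + PowerSeries.X) ^ 3 = 1 := by
    rw [← PowerSeries.binomialSeries_nat (R := ℝ) 3, pow_two, ← PowerSeries.binomialSeries_add,
      ← PowerSeries.binomialSeries_add, ← PowerSeries.binomialSeries_zero (R := ℝ)]
    congr 1
    norm_num
  have := congrArg (PowerSeries.rescale β) h
  simpa [auxU, PowerSeries.rescale_X] using this

lemma auxU_coeff (β : ℝ) (n : ℕ) :
    PowerSeries.coeff n (auxU β) = β ^ n * Ring.choose (-3/2 : ℝ) n := by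
  simp [auxU, PowerSeries.coeff_rescale]

noncomputable def auxH (k : ℕ) (β : ℝ) : PowerSeries ℝ :=
  auxU β * (1 + PowerSeries.C (1/2) * PowerSeries.X ^ k)

lemma auxH_eq (k : ℕ) (β : ℝ) : auxH k β ^ 2 * (1 + PowerSeries.C β * PowerSeries.X) ^ 3
    = 1 + PowerSeries.X ^ k + PowerSeries.C (1/4) * PowerSeries.X ^ (2 * k) := by
  have h2 : (PowerSeries.C (1/2 : ℝ)) * 2 = 1 := by
    rw [← map_ofNat (PowerSeries.C (R := ℝ)) 2, ← map_mul]; norm_num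
  have h4 : (PowerSeries.C (1/2 : ℝ)) ^ 2 = PowerSeries.C (1/4) := by
    rw [← map_pow]; norm_num
  rw [auxH, ← h4]
  linear_combination (1 + PowerSeries.C (1/2) * PowerSeries.X ^ k)^2 * auxU_eq β
    + PowerSeries.X ^ k * h2

lemma auxH_coeff_zero (k : ℕ) (hk : 1 ≤ k) (β : ℝ) : PowerSeries.coeff 0 (auxH k β) = 1 := by
  have h := auxU_coeff β 0
  simp at h
  simp [auxH, h]
  omega

lemma auxH_coeff_self (k : ℕ) (β : ℝ) :
    PowerSeries.coeff k (auxH k β) = β ^ k * Ring.choose (-3/2 : ℝ) k + 1/2 := by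
  have h := auxU_coeff β 0
  simp at h
  have e : auxH k β = auxU β + PowerSeries.C (1/2) * (auxU β * PowerSeries.X ^ k) := by
    rw [auxH]; ring
  rw [e, map_add, auxU_coeff, PowerSeries.coeff_C_mul, PowerSeries.coeff_mul_X_pow']
  simp [h]

lemma aux_series (k : ℕ) (hk : 1 ≤ k) (β : ℝ) (q : PowerSeries ℝ)
    (hq : PowerSeries.coeff 0 q = 1) :
    PowerSeries.X ^ (k+1) ∣ q ^ 2 * (1 + PowerSeries.C β * PowerSeries.X) ^ 3 - 1
      - PowerSeries.X ^ k ↔ PowerSeries.X ^ (k+1) ∣ q - auxH k β := by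
  have h0 := auxH_coeff_zero k hk β
  have hu : IsUnit ((q + auxH k β) * (1 + PowerSeries.C β * PowerSeries.X) ^ 3) := by
    rw [PowerSeries.isUnit_iff_constantCoeff]
    simp at h0 hq
    simp [h0, hq]
  have e : q ^ 2 * (1 + PowerSeries.C β * PowerSeries.X) ^ 3 - 1 - PowerSeries.X ^ k
      = (q - auxH k β) * ((q + auxH k β) * (1 + PowerSeries.C β * PowerSeries.X) ^ 3)
        + PowerSeries.X ^ (k+1) * (PowerSeries.C (1/4) * PowerSeries.X ^ (k - 1)) := by
    have e2 : (PowerSeries.X : PowerSeries ℝ) ^ (2 * k)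
        = PowerSeries.X ^ (k+1) * PowerSeries.X ^ (k-1) := by
      rw [← pow_add]; congr 1; omega
    have := auxH_eq k β
    rw [e2] at this
    linear_combination this
  rw [e, dvd_add_left (dvd_mul_right _ _), hu.dvd_mul_right]

lemma aux_main (k : ℕ) (hk : 1 ≤ k) (β : ℝ) (Q : Polynomial ℝ) (hQ : Q.Monic)
    (hd : Q.natDegree = k - 1) :
    (Q ^ 2 * (X + C β) ^ 3 - X ^ (2 * k + 1) - X ^ (k + 1)).degree ≤ (k : WithBot ℕ) ↔
    ∀ i ≤ k, (reflect (k-1) Q).coeff i = PowerSeries.coeff i (auxH k β) := by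
  set P := Q ^ 2 * (X + C β) ^ 3 - X ^ (2 * k + 1) - X ^ (k + 1) with hP
  have hlin : (X + C β : ℝ[X]).natDegree ≤ 1 := (natDegree_X_add_C β).le
  have hdeg : P.natDegree ≤ 2 * k + 1 := by
    have h1 : (Q ^ 2 * (X + C β) ^ 3).natDegree ≤ 2 * k + 1 := by
      refine natDegree_mul_le.trans ?_
      have a1 := natDegree_pow_le (p := Q) (n := 2)
      have a2 := natDegree_pow_le (p := (X + C β : ℝ[X])) (n := 3)
      rw [natDegree_X_add_C] at a2
      omega
    refine (natDegree_sub_le_of_le (natDegree_sub_le_of_le h1 (natDegree_X_pow_le _))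
      (natDegree_X_pow_le _)).trans ?_
    simp; omega
  have hr : reflect (2 * k + 1) P
      = (reflect (k-1) Q) ^ 2 * (1 + C β * X) ^ 3 - 1 - X ^ k := by
    have hl : reflect 1 (X + C β) = 1 + C β * X := by simp [reflect_C]
    have h2 : reflect ((k-1)+(k-1)) (Q^2) = (reflect (k-1) Q) ^ 2 := by
      rw [pow_two, pow_two, reflect_mul _ _ hd.le hd.le]
    have h3 : reflect (1+1+1) ((X + C β)^3) = (1 + C β * X)^3 := by
      rw [pow_succ, pow_two, reflect_mul _ _ (natDegree_mul_le_of_le hlin hlin) hlin,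
        reflect_mul _ _ hlin hlin, hl]
      ring
    have h4 : reflect (2 * k + 1) (Q ^ 2 * (X + C β) ^ 3)
        = (reflect (k-1) Q) ^ 2 * (1 + C β * X) ^ 3 := by
      rw [← h2, ← h3, ← reflect_mul]
      · congr 1; omega
      · have a1 := natDegree_pow_le (p := Q) (n := 2)
        omega
      · have a2 := natDegree_pow_le (p := (X + C β : ℝ[X])) (n := 3)
        omega
    rw [hP, reflect_sub, reflect_sub, h4, reflect_monomial, reflect_monomial, revAt_le le_rfl,
      revAt_le (by omega)]
    congr 2
    · simp
    · omega
  have hA : P.degree ≤ (k : WithBot ℕ) ↔ ∀ i < k + 1, (reflect (2*k+1) P).coeff i = 0 := by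
    rw [← natDegree_le_iff_degree_le, natDegree_le_iff_coeff_eq_zero]
    constructor
    · intro h i hi
      rw [coeff_reflect, revAt_le (by omega)]
      exact h _ (by omega)
    · intro h n hn
      by_cases hn2 : n ≤ 2 * k + 1
      · have := h (2*k+1-n) (by omega)
        rw [coeff_reflect, revAt_le (by omega)] at this
        rwa [show 2 * k + 1 - (2*k+1-n) = n by omega] at this
      · exact coeff_eq_zero_of_natDegree_lt (by omega)
  have h0 : PowerSeries.coeff 0 ((reflect (k-1) Q : ℝ[X]) : PowerSeries ℝ) = 1 := by
    rw [Polynomial.coeff_coe, coeff_reflect, revAt_zero, ← hd]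
    exact hQ
  have hS := aux_series k hk β _ h0
  rw [PowerSeries.X_pow_dvd_iff, PowerSeries.X_pow_dvd_iff] at hS
  have hc : (((reflect (k-1) Q) : PowerSeries ℝ) ^ 2
      * (1 + PowerSeries.C β * PowerSeries.X) ^ 3 - 1 - PowerSeries.X ^ k)
      = ((reflect (2*k+1) P : ℝ[X]) : PowerSeries ℝ) := by
    rw [hr]; simp
  rw [hc] at hS
  simp only [Polynomial.coeff_coe, map_sub, sub_eq_zero] at hS
  rw [hA, hS]
  simp only [Nat.lt_succ_iff]

theorem stmt_12 (k : ℕ) (hk : 1 ≤ k) (hodd : Odd k) :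
    (∃! qb : Polynomial ℝ × ℝ, qb.1.Monic ∧ qb.1.natDegree = k - 1 ∧
      (qb.1 ^ 2 * (X + C qb.2) ^ 3 - X ^ (2 * k + 1) - X ^ (k + 1)).degree
        ≤ (k : WithBot ℕ)) ∧
    ∀ (Q : Polynomial ℝ) (β : ℝ), Q.Monic → Q.natDegree = k - 1 →
      (Q ^ 2 * (X + C β) ^ 3 - X ^ (2 * k + 1) - X ^ (k + 1)).degree ≤ (k : WithBot ℕ) →
        0 < β := by
  have hs := aux_sign k
  rw [hodd.neg_one_pow] at hs
  set c := Ring.choose (-3/2 : ℝ) k with hc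
  have hc0 : c < 0 := by linarith
  have hcne : c ≠ 0 := hc0.ne
  have hb : 0 < -1/(2*c) := div_pos_of_neg_of_neg (by norm_num) (by linarith)
  have key : ∀ (Q : Polynomial ℝ) (β : ℝ), Q.Monic → Q.natDegree = k - 1 →
      (Q ^ 2 * (X + C β) ^ 3 - X ^ (2 * k + 1) - X ^ (k + 1)).degree ≤ (k : WithBot ℕ) →
        β ^ k = -1/(2*c) := by
    intro Q β hQ hd h
    rw [aux_main k hk β Q hQ hd] at h
    have h1 := h k le_rfl
    rw [auxH_coeff_self, coeff_reflect, revAt_eq_self_of_lt (by omega),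
      coeff_eq_zero_of_natDegree_lt (by omega), ← hc] at h1
    field_simp
    linarith
  obtain ⟨β, hβ⟩ : ∃ β : ℝ, β ^ k = -1/(2*c) :=
    ⟨(-1/(2*c)) ^ ((k:ℝ)⁻¹), Real.rpow_inv_natCast_pow hb.le (by omega)⟩
  refine ⟨?_, fun Q β hQ hd h => ?_⟩
  · have hk0 : PowerSeries.coeff k (auxH k β) = 0 := by
      rw [auxH_coeff_self, hβ, ← hc]
      field_simp
      norm_num
    set q := PowerSeries.trunc k (auxH k β) with hq
    have hqc : ∀ i, q.coeff i = if i < k then PowerSeries.coeff i (auxH k β) else 0 :=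
      fun i => PowerSeries.coeff_trunc _ _ _
    have hqd : q.natDegree ≤ k - 1 := by
      rw [natDegree_le_iff_coeff_eq_zero]
      intro n hn
      rw [hqc, if_neg (by omega)]
    have hQd : (reflect (k-1) q).natDegree ≤ k - 1 := by
      refine natDegree_reflect_le.trans ?_
      simp [hqd]
    have hQc : (reflect (k-1) q).coeff (k-1) = 1 := by
      rw [coeff_reflect, revAt_le le_rfl, Nat.sub_self, hqc, if_pos (by omega),
        auxH_coeff_zero k hk]
    have hQm : (reflect (k-1) q).Monic := monic_of_natDegree_le_of_coeff_eq_one _ hQd hQc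
    have hQn : (reflect (k-1) q).natDegree = k - 1 :=
      le_antisymm hQd (le_natDegree_of_ne_zero (by rw [hQc]; norm_num))
    refine ⟨(reflect (k-1) q, β), ⟨hQm, hQn, ?_⟩, ?_⟩
    · refine (aux_main k hk β _ hQm hQn).2 ?_
      intro i hi
      rw [reflect_reflect, hqc]
      split_ifs with h
      · rfl
      · rw [show i = k by omega, hk0]
    · rintro ⟨Q, β'⟩ ⟨hm, hd, h⟩
      simp only at hm hd h
      have hββ : β' = β := hodd.strictMono_pow.injective ((key Q β' hm hd h).trans hβ.symm)
      subst hββ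
      rw [aux_main k hk _ Q hm hd] at h
      have : reflect (k-1) Q = q := by
        ext i
        rw [hqc]
        split_ifs with hi
        · exact h i hi.le
        · rw [coeff_reflect, revAt_eq_self_of_lt (by omega)]
          exact coeff_eq_zero_of_natDegree_lt (by omega)
      rw [← this, reflect_reflect]
  · have := key Q β hQ hd h
    rw [← hodd.pow_pos_iff, this]
    exact hb
end

section
/- For every natural number n ≥ 1, the set {c ∈ ℂ : the polynomial X^(n+1) + X + C c over ℂ is not squarefree (i.e., has a repeated complex root)} is finite of cardinality exactly n. -/
open Polynomial

theorem stmt_13 (n : ℕ) (hn : 1 ≤ n) :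
    {c : ℂ | ¬ Squarefree (X ^ (n + 1) + X + C c : Polynomial ℂ)}.Finite ∧
    {c : ℂ | ¬ Squarefree (X ^ (n + 1) + X + C c : Polynomial ℂ)}.ncard = n := by
  have h1 : (n : ℂ) + 1 ≠ 0 := by exact_mod_cast Nat.succ_ne_zero n
  have h0 : (n : ℂ) ≠ 0 := by exact_mod_cast (by omega : n ≠ 0)
  have hne : (X ^ n - C (-1 / ((n : ℂ) + 1)) : ℂ[X]) ≠ 0 := X_pow_sub_C_ne_zero (by omega) _
  have hmem : ∀ x : ℂ, x ∈ (X ^ n - C (-1 / ((n : ℂ) + 1)) : ℂ[X]).rootSet ℂ ↔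
      ((n : ℂ) + 1) * x ^ n + 1 = 0 := by
    intro x
    rw [mem_rootSet_of_ne hne]
    simp only [map_sub, map_pow, aeval_X, aeval_C, Algebra.algebraMap_self, RingHom.id_apply]
    rw [sub_eq_zero, eq_div_iff h1]
    constructor <;> intro h <;> linear_combination h
  have himg : {c : ℂ | ¬ Squarefree (X ^ (n + 1) + X + C c : Polynomial ℂ)} =
      (fun x : ℂ => -(n / (n + 1)) * x) ''
        ((X ^ n - C (-1 / ((n : ℂ) + 1)) : ℂ[X]).rootSet ℂ) := by
    ext c
    rw [Set.mem_setOf_eq, ← PerfectField.separable_iff_squarefree, Polynomial.Separable,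
      isCoprime_iff_aeval_ne_zero_of_isAlgClosed ℂ ℂ]
    push Not
    simp only [Set.mem_image, hmem]
    refine exists_congr fun x => ?_
    simp only [derivative_add, derivative_X_pow, derivative_X, derivative_C, map_add, map_mul,
      map_pow, aeval_X, aeval_C, Algebra.algebraMap_self, RingHom.id_apply, map_natCast, map_one,
      add_zero, Nat.add_sub_cancel, Nat.cast_add, Nat.cast_one]
    constructor
    · rintro ⟨ha, hb⟩
      refine ⟨hb, ?_⟩
      field_simp
      linear_combination x * hb - (n + 1) * ha
    · rintro ⟨hb, rfl⟩
      refine ⟨?_, hb⟩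
      field_simp
      linear_combination x * hb
  have hcard : ((X ^ n - C (-1 / ((n : ℂ) + 1)) : ℂ[X]).rootSet ℂ).ncard = n := by
    rw [← Nat.card_coe_set_eq, Nat.card_eq_fintype_card, card_rootSet_eq_natDegree
      (separable_X_pow_sub_C _ h0 (div_ne_zero (by norm_num) h1))
      (IsAlgClosed.splits _), natDegree_X_pow_sub_C]
  rw [himg]
  refine ⟨(rootSet_finite _ _).image _, ?_⟩
  rw [Set.ncard_image_of_injective, hcard]
  exact mul_right_injective₀ (neg_ne_zero.2 (div_ne_zero h0 h1))
end
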